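/- Let m, n be positive integers and let A ∈ M_{m,n}(ℝ) be non-singular, and let ε > 0 be such that the ε-return sequence L(ε) = {ℓ_1 < ℓ_2 < ⋯} is infinite. Then for any decreasing function ψ : ℝ⁺ → ℝ⁺ and any 0 ≤ s ≤ m: if ∑_{i=1}^∞ 2^{ℓ_i n} ψ(2^{ℓ_i})^s = ∞, then ℋ^s(W_A(ψ)) = ℋ^s([0,1]^m). -/

import Mathlib

open MeasureTheory Filter

/-- Distance from `x ∈ ℝ^k` to the nearest integer vector, in the sup norm. -/
noncomputable def intDist {k : ℕ} (x : Fin k → ℝ) : ℝ :=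
  ⨅ p : Fin k → ℤ, ‖x - (fun i => (p i : ℝ))‖

/-- The set `W_A(ψ)` of `ψ`-approximable targets `b ∈ [0,1]^m` for `A`. -/
noncomputable def WA (m n : ℕ) (A : Matrix (Fin m) (Fin n) ℝ) (ψ : ℝ → ℝ) :
    Set (Fin m → ℝ) :=
  {b | b ∈ Set.Icc (0 : Fin m → ℝ) 1 ∧
    {q : Fin n → ℤ |
      intDist (A.mulVec (fun j => (q j : ℝ)) - b) < ψ ‖(fun j => (q j : ℝ))‖}.Infinite}

/-- `ℓ` belongs to the `ε`-return sequence `L(ε)` of `A`: there is no `q ∈ ℤ^n` with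
`‖Aq‖_ℤ < ε 2^{-nℓ/m}` and `0 < ‖q‖ < 2^ℓ`. -/
def InReturnSeq (m n : ℕ) (A : Matrix (Fin m) (Fin n) ℝ) (ε : ℝ) (ℓ : ℕ) : Prop :=
  1 ≤ ℓ ∧ ¬ ∃ q : Fin n → ℤ,
    intDist (A.mulVec (fun j => (q j : ℝ))) < ε * (2 : ℝ) ^ (-(n : ℝ) * ℓ / m) ∧
    0 < ‖(fun j => (q j : ℝ))‖ ∧ ‖(fun j => (q j : ℝ))‖ < 2 ^ ℓ

open scoped ENNReal NNReal Topology

theorem exists_finset_disjoint_closedBalls {m : ℕ} {O : Set (Fin m → ℝ)}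
    (P : (Fin m → ℝ) → ℝ → ℝ → Prop) (hO : IsOpen O)
    (hcov : ∀ᵐ x : Fin m → ℝ, x ∈ O → ∀ τ > 0, ∃ y ρ σ,
      0 < ρ ∧ ρ ≤ τ ∧ dist x y ≤ ρ ∧ P y ρ σ)
    (μ : Measure (Fin m → ℝ)) [IsProbabilityMeasure μ] (hμ : μ ≪ volume) (hμO : μ Oᶜ = 0)
    {τ t : ℝ} (hτ : 0 < τ) (ht : t < 1) :
    ∃ u : Finset ((Fin m → ℝ) × ℝ × ℝ),
      (∀ a ∈ u, 0 < a.2.1 ∧ a.2.1 ≤ τ ∧ Metric.closedBall a.1 a.2.1 ⊆ O ∧ P a.1 a.2.1 a.2.2) ∧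
      (u : Set ((Fin m → ℝ) × ℝ × ℝ)).PairwiseDisjoint (fun a => Metric.closedBall a.1 a.2.1) ∧
      t < μ.real (⋃ a ∈ u, Metric.closedBall a.1 a.2.1) := by
  let G : Set (Fin m → ℝ) := {x | x ∈ O ∧ ∀ τ > 0, ∃ y ρ σ, 0 < ρ ∧ ρ ≤ τ ∧ dist x y ≤ ρ ∧ P y ρ σ}
  let T : Set ((Fin m → ℝ) × (Fin m → ℝ) × ℝ × ℝ) := {a | 0 < a.2.2.1 ∧ a.2.2.1 ≤ τ ∧ dist a.1 a.2.1 ≤ a.2.2.1 ∧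
    Metric.closedBall a.2.1 a.2.2.1 ⊆ O ∧ P a.2.1 a.2.2.1 a.2.2.2}
  obtain ⟨v, hvT, hvc, hvd, hv0⟩ := Vitali.exists_disjoint_covering_ae (volume : Measure (Fin m → ℝ)) G T
    (6 ^ m) (fun a => 2 * a.2.2.1) (fun a => a.1) (fun a => Metric.closedBall a.2.1 a.2.2.1)
    (by
      intro a ha z hz
      have h1 := ha.2.2.1
      have h2 := Metric.mem_closedBall.1 hz
      have h3 := dist_triangle_right z a.1 a.2.1
      exact Metric.mem_closedBall.2 (by linarith))
    (by
      intro a ha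
      have h0 := ha.1
      have e1 : volume (Metric.closedBall a.1 (3 * (2 * a.2.2.1)))
          = ENNReal.ofReal ((2 * (3 * (2 * a.2.2.1))) ^ m) := by
        rw [Real.volume_pi_closedBall _ (by positivity)]; simp
      have e2 : volume (Metric.closedBall a.2.1 a.2.2.1)
          = ENNReal.ofReal ((2 * a.2.2.1) ^ m) := by
        rw [Real.volume_pi_closedBall _ (by positivity)]; simp
      rw [e1, e2]
      have : ((6 ^ m : ℝ≥0) : ℝ≥0∞) = ENNReal.ofReal (6 ^ m) := by
        rw [ENNReal.ofReal_pow (by norm_num)]; simp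
      rw [this, ← ENNReal.ofReal_mul (by positivity), ← mul_pow]
      apply le_of_eq; congr 2; ring)
    (by
      intro a ha
      have h0 := ha.1
      exact ⟨a.2.1, Metric.ball_subset_interior_closedBall (Metric.mem_ball_self h0)⟩)
    (fun a _ => Metric.isClosed_closedBall)
    (by
      intro x hx e he
      obtain ⟨r, hr, hrO⟩ := Metric.isOpen_iff.1 hO x hx.1
      obtain ⟨y, ρ, σ, h0, hτ', hd, hP⟩ := hx.2 (min τ (min (e / 2) (r / 3))) (by positivity)
      have a1 := hτ'.trans (min_le_left _ _)
      have a2 := hτ'.trans ((min_le_right _ _).trans (min_le_left _ _))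
      have a3 := hτ'.trans ((min_le_right _ _).trans (min_le_right _ _))
      refine ⟨(x, y, ρ, σ), ⟨h0, a1, hd, fun z hz => hrO ?_, hP⟩, by dsimp; linarith, rfl⟩
      have := dist_triangle_right z x y
      have hz' := Metric.mem_closedBall.1 hz
      dsimp at hz'
      exact Metric.mem_ball.2 (by linarith))
  have hG : volume (O \ G) = 0 := by
    refine measure_mono_null ?_ (ae_iff.1 hcov)
    intro x hx hx2
    exact hx.2 ⟨hx.1, fun τ hτ => hx2 hx.1 τ hτ⟩
  have hfull : μ (⋃ a ∈ v, Metric.closedBall a.2.1 a.2.2.1) = 1 := by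
    have hnull : μ (⋃ a ∈ v, Metric.closedBall a.2.1 a.2.2.1)ᶜ = 0 := by
      refine measure_mono_null (t := Oᶜ ∪ ((O \ G) ∪
        (G \ ⋃ a ∈ v, Metric.closedBall a.2.1 a.2.2.1))) ?_ ?_
      · intro x hx
        by_cases h1 : x ∈ O
        · by_cases h2 : x ∈ G
          · exact Or.inr (Or.inr ⟨h2, hx⟩)
          · exact Or.inr (Or.inl ⟨h1, h2⟩)
        · exact Or.inl h1
      · exact measure_union_null hμO (measure_union_null (hμ hG) (hμ hv0))
    rwa [prob_compl_eq_zero_iff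
      (MeasurableSet.biUnion hvc fun a _ => Metric.isClosed_closedBall.measurableSet)] at hnull
  have hsum : ∑' a : v, μ (Metric.closedBall a.1.2.1 a.1.2.2.1) = 1 := by
    rw [← hfull, measure_biUnion hvc hvd (fun a _ => Metric.isClosed_closedBall.measurableSet)]
  have hlt : ENNReal.ofReal t < ∑' a : v, μ (Metric.closedBall a.1.2.1 a.1.2.2.1) := by
    rw [hsum]; exact ENNReal.ofReal_lt_one.2 ht
  obtain ⟨w, hw⟩ := (ENNReal.summable.hasSum.eventually (lt_mem_nhds hlt)).exists
  classical
  refine ⟨w.image (fun a => a.1.2), ?_, ?_, ?_⟩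
  · intro a ha
    obtain ⟨b, hb, rfl⟩ := Finset.mem_image.1 ha
    obtain ⟨h1, h2, h3, h4, h5⟩ := hvT b.2
    exact ⟨h1, h2, h4, h5⟩
  · intro a ha b hb hab
    obtain ⟨a', ha', rfl⟩ := Finset.mem_image.1 (Finset.mem_coe.1 ha)
    obtain ⟨b', hb', rfl⟩ := Finset.mem_image.1 (Finset.mem_coe.1 hb)
    exact hvd a'.2 b'.2 (fun h => hab (by rw [h]))
  · have : (⋃ a ∈ w.image (fun a => a.1.2), Metric.closedBall a.1 a.2.1)
        = ⋃ a ∈ w, Metric.closedBall a.1.2.1 a.1.2.2.1 := by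
      rw [Finset.set_biUnion_finset_image]
    rw [this]
    rw [← measure_biUnion_finset
      (s := w) (f := fun a : v => Metric.closedBall a.1.2.1 a.1.2.2.1)
      (fun a _ b _ hab => hvd a.2 b.2 (fun h => hab (Subtype.ext h)))
      (fun a _ => Metric.isClosed_closedBall.measurableSet)] at hw
    rw [← ofReal_measureReal (measure_ne_top _ _)] at hw
    exact (ENNReal.ofReal_lt_ofReal_iff'.1 hw).1

theorem cond_ball_real_closedBall_le {m : ℕ} (y x : Fin m → ℝ) {σ r : ℝ} (hσ : 0 < σ)
    (hr : 0 ≤ r) :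
    (ProbabilityTheory.cond volume (Metric.ball y σ)).real (Metric.closedBall x r)
      ≤ (r / σ) ^ m := by
  rw [measureReal_def, ProbabilityTheory.cond_apply measurableSet_ball, ENNReal.toReal_mul,
    ENNReal.toReal_inv, Real.volume_pi_ball _ hσ, ENNReal.toReal_ofReal (by positivity)]
  have h : (volume (Metric.ball y σ ∩ Metric.closedBall x r)).toReal ≤ (2 * r) ^ m := by
    refine ENNReal.toReal_le_of_le_ofReal (by positivity)
      ((measure_mono Set.inter_subset_right).trans ?_)
    rw [Real.volume_pi_closedBall _ hr]; simp
  calc _ ≤ ((2 * σ) ^ Fintype.card (Fin m))⁻¹ * (2 * r) ^ m := by gcongr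
    _ = _ := by
      rw [Fintype.card_fin, ← inv_pow, ← mul_pow]
      congr 1
      field_simp

theorem cond_ball_isProbabilityMeasure {m : ℕ} (y : Fin m → ℝ) {σ : ℝ} (hσ : 0 < σ) :
    IsProbabilityMeasure (ProbabilityTheory.cond volume (Metric.ball y σ)) :=
  ProbabilityTheory.cond_isProbabilityMeasure_of_finite
    (Metric.measure_ball_pos _ _ hσ).ne' measure_ball_lt_top.ne

theorem cond_ball_eq_zero_of_disjoint {m : ℕ} {y : Fin m → ℝ} {σ : ℝ} {S : Set (Fin m → ℝ)}
    (h : Disjoint (Metric.ball y σ) S) :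
    (ProbabilityTheory.cond volume (Metric.ball y σ)) S = 0 := by
  rw [ProbabilityTheory.cond_apply measurableSet_ball, Set.disjoint_iff_inter_eq_empty.1 h]
  simp

/-- The measure obtained by spreading mass `w a` uniformly over each ball `B(y, σ)`, for
`a = (y, ρ, σ)` in a finite family. -/
noncomputable def spread {m : ℕ} (u : Finset ((Fin m → ℝ) × ℝ × ℝ))
    (w : (Fin m → ℝ) × ℝ × ℝ → ℝ) : Measure (Fin m → ℝ) :=
  ∑ a ∈ u, ENNReal.ofReal (w a) • ProbabilityTheory.cond volume (Metric.ball a.1 a.2.2)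

theorem spread_apply {m : ℕ} (u : Finset ((Fin m → ℝ) × ℝ × ℝ))
    (w : (Fin m → ℝ) × ℝ × ℝ → ℝ) (S : Set (Fin m → ℝ)) :
    spread u w S = ∑ a ∈ u, ENNReal.ofReal (w a) *
      ProbabilityTheory.cond volume (Metric.ball a.1 a.2.2) S := by
  simp [spread, Measure.finsetSum_apply]

theorem spread_real {m : ℕ} (u : Finset ((Fin m → ℝ) × ℝ × ℝ))
    (w : (Fin m → ℝ) × ℝ × ℝ → ℝ) (hw : ∀ a ∈ u, 0 ≤ w a) (hσ : ∀ a ∈ u, 0 < a.2.2)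
    (S : Set (Fin m → ℝ)) :
    (spread u w).real S = ∑ a ∈ u, w a *
      (ProbabilityTheory.cond volume (Metric.ball a.1 a.2.2)).real S := by
  rw [measureReal_def, spread_apply, ENNReal.toReal_sum]
  · refine Finset.sum_congr rfl fun a ha => ?_
    rw [ENNReal.toReal_mul, ENNReal.toReal_ofReal (hw a ha), measureReal_def]
  · intro a ha
    have := cond_ball_isProbabilityMeasure a.1 (hσ a ha)
    exact ENNReal.mul_ne_top ENNReal.ofReal_ne_top (measure_ne_top _ _)

theorem spread_absolutelyContinuous {m : ℕ} (u : Finset ((Fin m → ℝ) × ℝ × ℝ))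
    (w : (Fin m → ℝ) × ℝ × ℝ → ℝ) : spread u w ≪ volume := by
  intro S hS
  rw [spread_apply]
  refine Finset.sum_eq_zero fun a _ => ?_
  rw [ProbabilityTheory.cond_absolutelyContinuous hS, mul_zero]

theorem exists_refined_measure {m : ℕ} {s κ D : ℝ} (hs0 : 0 ≤ s) (hsm : s < m)
    (hκ : 0 < κ) (hD : 0 ≤ D) {U O : Set (Fin m → ℝ)} (hO : IsOpen O)
    (hcov : ∀ η > 0, ∀ᵐ x : Fin m → ℝ, x ∈ O → ∀ τ > 0, ∃ y ρ σ,
      0 < ρ ∧ ρ ≤ τ ∧ dist x y ≤ ρ ∧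
      (0 < σ ∧ 2 * σ ≤ ρ ∧ ρ ^ m ≤ η * σ ^ s ∧ Metric.closedBall y σ ⊆ U))
    (μ : Measure (Fin m → ℝ)) [IsProbabilityMeasure μ] (hμ : μ ≪ volume) (hμO : μ Oᶜ = 0)
    {M : ℝ} (hM : ∀ x, ∀ r > 0, μ.real (Metric.closedBall x r) ≤ M * r ^ m)
    {c c' : ℝ} (hc : 1 ≤ c) (hcc : c < c')
    (hμc : ∀ x, ∀ r > 0, μ.real (Metric.closedBall x r) ≤ c * (κ * r ^ s + D * r ^ m)) :
    ∃ (O' K' : Set (Fin m → ℝ)) (μ' : Measure (Fin m → ℝ)) (M' : ℝ),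
      IsOpen O' ∧ IsCompact K' ∧ O' ⊆ K' ∧ K' ⊆ O ∧ K' ⊆ U ∧ IsProbabilityMeasure μ' ∧
      μ' ≪ volume ∧ μ' O'ᶜ = 0 ∧
      (∀ x, ∀ r > 0, μ'.real (Metric.closedBall x r) ≤ M' * r ^ m) ∧
      (∀ x, ∀ r > 0, μ'.real (Metric.closedBall x r) ≤ c' * (κ * r ^ s + D * r ^ m)) := by
  have hM0 : 0 ≤ M := by
    have h := (measureReal_nonneg (μ := μ) (s := Metric.closedBall 0 1)).trans
      (hM 0 1 one_pos)
    simpa using h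
  have hc0 : 0 < c := by linarith
  have hc'0 : 0 < c' := by linarith
  -- below the scale `r₁`, the bound by `M r ^ m` is much stronger than the one by `κ r ^ s`
  obtain ⟨r₁, hr₁, hr₁'⟩ : ∃ r₁ > 0, ∀ r, 0 < r → r ≤ r₁ →
      c' * (M * (9 * r) ^ m) ≤ c' * (κ * r ^ s) := by
    have hlim : Tendsto (fun r : ℝ => M * 9 ^ m * r ^ ((m : ℝ) - s)) (𝓝[>] 0) (𝓝 0) := by
      have h1 : Tendsto (fun r : ℝ => r ^ ((m : ℝ) - s)) (𝓝[>] 0) (𝓝 0) := by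
        have := (Real.continuousAt_rpow_const 0 ((m : ℝ) - s) (Or.inr (by linarith))).tendsto
        rw [Real.zero_rpow (by linarith)] at this
        exact this.mono_left nhdsWithin_le_nhds
      simpa using h1.const_mul (M * 9 ^ m)
    obtain ⟨r₁, hr₁, h⟩ := mem_nhdsGT_iff_exists_Ioc_subset.1 (hlim.eventually (gt_mem_nhds hκ))
    refine ⟨r₁, hr₁, fun r hr hrr => mul_le_mul_of_nonneg_left ?_ hc'0.le⟩
    have h2 : M * 9 ^ m * r ^ ((m : ℝ) - s) < κ := h ⟨hr, hrr⟩
    calc M * (9 * r) ^ m = M * 9 ^ m * r ^ ((m : ℝ) - s) * r ^ s := by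
          rw [mul_assoc, ← Real.rpow_add hr, sub_add_cancel, Real.rpow_natCast, mul_pow, mul_assoc]
      _ ≤ κ * r ^ s := by gcongr
  obtain ⟨c₁, hcc₁, hc₁c'⟩ := exists_between hcc
  -- above the scale `r₁`, enlarging a ball by `2 τ` does not matter
  obtain ⟨τ, hτ, hτ'⟩ : ∃ τ > 0, c * (1 + 2 * τ / r₁) ^ m ≤ c₁ := by
    have hlim : Tendsto (fun τ : ℝ => c * (1 + 2 * τ / r₁) ^ m) (𝓝[>] 0) (𝓝 c) := by
      have : Continuous fun τ : ℝ => c * (1 + 2 * τ / r₁) ^ m := by fun_prop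
      have := (this.tendsto 0).mono_left (nhdsWithin_le_nhds (s := Set.Ioi 0))
      simpa using this
    obtain ⟨τ, h1, h2⟩ := ((hlim.eventually (gt_mem_nhds hcc₁)).and self_mem_nhdsWithin).exists
    exact ⟨τ, h2, h1.le⟩
  set η : ℝ := κ / (M + 1) with hη
  have hη0 : 0 < η := by positivity
  obtain ⟨u, hu, hud, hut⟩ := exists_finset_disjoint_closedBalls _ hO (hcov η hη0) μ hμ hμO hτ
    (t := c₁ / c') ((div_lt_one hc'0).2 hc₁c')
  set T := μ.real (⋃ a ∈ u, Metric.closedBall a.1 a.2.1) with hT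
  have hc₁0 : 0 < c₁ := by linarith
  have hT0 : 0 < T := lt_trans (by positivity) hut
  have hTinv : c₁ * T⁻¹ ≤ c' := by
    rw [div_lt_iff₀ hc'0] at hut
    rw [← div_eq_mul_inv, div_le_iff₀ hT0]; linarith
  have hTinv' : T⁻¹ ≤ c' := le_trans (le_mul_of_one_le_left (by positivity) (by linarith)) hTinv
  let w : (Fin m → ℝ) × ℝ × ℝ → ℝ := fun a => T⁻¹ * μ.real (Metric.closedBall a.1 a.2.1)
  have hw : ∀ a, 0 ≤ w a := fun a => by positivity
  have hσ : ∀ a ∈ u, 0 < a.2.2 := fun a ha => (hu a ha).2.2.2.1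
  have hsumw : ∀ v ⊆ u, ∑ a ∈ v, w a = T⁻¹ * μ.real (⋃ a ∈ v, Metric.closedBall a.1 a.2.1) := by
    intro v hv
    rw [measureReal_biUnion_finset (hud.subset (by exact_mod_cast hv))
      (fun a _ => Metric.isClosed_closedBall.measurableSet), Finset.mul_sum]
  have hprob : IsProbabilityMeasure (spread u w) := by
    constructor
    rw [spread_apply]
    have : ∑ a ∈ u, ENNReal.ofReal (w a) *
        ProbabilityTheory.cond volume (Metric.ball a.1 a.2.2) Set.univ
        = ∑ a ∈ u, ENNReal.ofReal (w a) := by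
      refine Finset.sum_congr rfl fun a ha => ?_
      have := cond_ball_isProbabilityMeasure a.1 (hσ a ha)
      rw [measure_univ, mul_one]
    rw [this, ← ENNReal.ofReal_sum_of_nonneg (fun a _ => hw a), hsumw u subset_rfl,
      inv_mul_cancel₀ hT0.ne', ENNReal.ofReal_one]
  have hreal := spread_real u w (fun a _ => hw a) hσ
  refine ⟨⋃ a ∈ u, Metric.ball a.1 a.2.2, ⋃ a ∈ u, Metric.closedBall a.1 a.2.2, spread u w,
    ∑ a ∈ u, w a * (a.2.2 ^ m)⁻¹, isOpen_biUnion fun a _ => Metric.isOpen_ball,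
    u.isCompact_biUnion fun a _ => isCompact_closedBall _ _,
    Set.iUnion₂_mono fun a _ => Metric.ball_subset_closedBall, ?_, ?_, hprob,
    spread_absolutelyContinuous u w, ?_, ?_, ?_⟩
  · refine Set.iUnion₂_subset fun a ha => ?_
    obtain ⟨h1, h2, h3, h4, h5, h6, h7⟩ := hu a ha
    exact (Metric.closedBall_subset_closedBall (by linarith)).trans h3
  · exact Set.iUnion₂_subset fun a ha => (hu a ha).2.2.2.2.2.2
  · rw [spread_apply]
    refine Finset.sum_eq_zero fun a ha => ?_
    rw [cond_ball_eq_zero_of_disjoint, mul_zero]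
    refine Set.disjoint_compl_right_iff_subset.2 ?_
    exact Set.subset_biUnion_of_mem (u := fun a : (Fin m → ℝ) × ℝ × ℝ => Metric.ball a.1 a.2.2) ha
  · intro x r hr
    rw [hreal, Finset.sum_mul]
    refine Finset.sum_le_sum fun a ha => ?_
    rw [mul_assoc (w a)]
    refine mul_le_mul_of_nonneg_left ?_ (hw a)
    refine (cond_ball_real_closedBall_le _ _ (hσ a ha) hr.le).trans (le_of_eq ?_)
    rw [div_pow]; ring
  · intro x r hr
    classical
    set v := u.filter fun a => (Metric.ball a.1 a.2.2 ∩ Metric.closedBall x r).Nonempty with hv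
    have hvu : v ⊆ u := Finset.filter_subset _ _
    have hrv : (spread u w).real (Metric.closedBall x r) = ∑ a ∈ v, w a *
        (ProbabilityTheory.cond volume (Metric.ball a.1 a.2.2)).real (Metric.closedBall x r) := by
      rw [hreal]
      refine (Finset.sum_subset hvu fun a ha hav => ?_).symm
      have : Disjoint (Metric.ball a.1 a.2.2) (Metric.closedBall x r) := by
        rw [Set.disjoint_iff_inter_eq_empty, ← Set.not_nonempty_iff_eq_empty]
        exact fun h => hav (Finset.mem_filter.2 ⟨ha, h⟩)
      rw [measureReal_def, cond_ball_eq_zero_of_disjoint this]; simp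
    have hle1 : (spread u w).real (Metric.closedBall x r) ≤ ∑ a ∈ v, w a := by
      rw [hrv]
      refine Finset.sum_le_sum fun a ha => ?_
      have := cond_ball_isProbabilityMeasure a.1 (hσ a (hvu ha))
      exact mul_le_of_le_one_right (hw a) measureReal_le_one
    have henl : ∀ R, (∀ a ∈ v, a.2.1 ≤ R) →
        (spread u w).real (Metric.closedBall x r)
          ≤ T⁻¹ * μ.real (Metric.closedBall x (r + 2 * R)) := by
      intro R hR
      refine hle1.trans ?_
      rw [hsumw v hvu]
      refine mul_le_mul_of_nonneg_left (measureReal_mono ?_ (measure_ne_top _ _)) (by positivity)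
      refine Set.iUnion₂_subset fun a ha z hz => ?_
      obtain ⟨h1, h2, h3, h4, h5, h6, h7⟩ := hu a (hvu ha)
      obtain ⟨y, hy1, hy2⟩ := (Finset.mem_filter.1 ha).2
      rw [Metric.mem_ball] at hy1
      rw [Metric.mem_closedBall] at hz hy2 ⊢
      have d1 := dist_triangle z y x
      have d2 := dist_triangle_right z y a.1
      have := hR a ha
      linarith
    have hg : 0 ≤ κ * r ^ s := by positivity
    have hg' : 0 ≤ D * r ^ m := by positivity
    rcases le_total r₁ r with hrr | hrr
    · have h1 : 1 ≤ 1 + 2 * τ / r₁ := by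
        have : 0 ≤ 2 * τ / r₁ := by positivity
        linarith
      have h2 : r + 2 * τ ≤ (1 + 2 * τ / r₁) * r := by
        have : 2 * τ ≤ 2 * τ / r₁ * r := by
          rw [div_mul_eq_mul_div, le_div_iff₀ hr₁]; gcongr
        linarith
      have h3 : κ * (r + 2 * τ) ^ s + D * (r + 2 * τ) ^ m
          ≤ (1 + 2 * τ / r₁) ^ m * (κ * r ^ s + D * r ^ m) := by
        have e1 : (r + 2 * τ) ^ s ≤ (1 + 2 * τ / r₁) ^ m * r ^ s := by
          calc (r + 2 * τ) ^ s ≤ ((1 + 2 * τ / r₁) * r) ^ s :=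
                Real.rpow_le_rpow (by positivity) h2 hs0
            _ = (1 + 2 * τ / r₁) ^ s * r ^ s := Real.mul_rpow (by positivity) hr.le
            _ ≤ (1 + 2 * τ / r₁) ^ (m : ℝ) * r ^ s := by
                gcongr
            _ = _ := by rw [Real.rpow_natCast]
        have e2 : (r + 2 * τ) ^ m ≤ (1 + 2 * τ / r₁) ^ m * r ^ m := by
          rw [← mul_pow]; gcongr
        calc _ ≤ κ * ((1 + 2 * τ / r₁) ^ m * r ^ s) + D * ((1 + 2 * τ / r₁) ^ m * r ^ m) := by
              gcongr
          _ = _ := by ring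
      calc (spread u w).real (Metric.closedBall x r)
          ≤ T⁻¹ * μ.real (Metric.closedBall x (r + 2 * τ)) :=
            henl τ fun a ha => (hu a (hvu ha)).2.1
        _ ≤ T⁻¹ * (c * ((1 + 2 * τ / r₁) ^ m * (κ * r ^ s + D * r ^ m))) := by
            gcongr
            refine (hμc x _ (by positivity)).trans ?_
            gcongr
        _ = (c * (1 + 2 * τ / r₁) ^ m) * T⁻¹ * (κ * r ^ s + D * r ^ m) := by ring
        _ ≤ c₁ * T⁻¹ * (κ * r ^ s + D * r ^ m) := by gcongr
        _ ≤ c' * (κ * r ^ s + D * r ^ m) := by gcongr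
    · suffices h : (spread u w).real (Metric.closedBall x r) ≤ c' * (κ * r ^ s) by
        refine h.trans ?_
        gcongr
        linarith
      by_cases hv1 : ∀ a ∈ v, a.2.1 ≤ 4 * r
      · calc _ ≤ T⁻¹ * μ.real (Metric.closedBall x (r + 2 * (4 * r))) := henl _ hv1
          _ ≤ c' * (M * (9 * r) ^ m) := by
              have := hM x (9 * r) (by positivity)
              rw [show r + 2 * (4 * r) = 9 * r by ring]
              gcongr
          _ ≤ _ := hr₁' r hr hrr
      · push Not at hv1
        obtain ⟨a, hav, har⟩ := hv1
        obtain ⟨h1, h2, h3, h4, h5, h6, h7⟩ := hu a (hvu hav)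
        have hva : v = {a} := by
          refine Finset.eq_singleton_iff_unique_mem.2 ⟨hav, fun b hb => ?_⟩
          by_contra hab
          have hdis := hud (hvu hb) (hvu hav) hab
          obtain ⟨y, hy1, hy2⟩ := (Finset.mem_filter.1 hav).2
          obtain ⟨z, hz1, hz2⟩ := (Finset.mem_filter.1 hb).2
          have hσb := (hu b (hvu hb)).2.2.2.2.1
          have hρb := (hu b (hvu hb)).1
          rw [Metric.mem_ball] at hy1 hz1
          rw [Metric.mem_closedBall] at hy2 hz2
          have d1 := dist_triangle z y a.1
          have d2 := dist_triangle_right z y x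
          exact Set.disjoint_left.1 hdis (Metric.mem_closedBall.2 (by linarith : dist z b.1 ≤ b.2.1))
            (Metric.mem_closedBall.2 (by linarith : dist z a.1 ≤ a.2.1))
        have hwa : w a ≤ c' * (κ * a.2.2 ^ s) := by
          calc w a = T⁻¹ * μ.real (Metric.closedBall a.1 a.2.1) := rfl
            _ ≤ c' * (M * (η * a.2.2 ^ s)) := by
                gcongr
                exact (hM _ _ h1).trans (by gcongr)
            _ = c' * ((M * η) * a.2.2 ^ s) := by ring
            _ ≤ c' * (κ * a.2.2 ^ s) := by
                gcongr
                rw [hη, mul_div_assoc', div_le_iff₀ (by positivity)]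
                nlinarith
        rcases le_total a.2.2 r with hσr | hσr
        · refine hle1.trans ?_
          rw [hva, Finset.sum_singleton]
          refine hwa.trans ?_
          gcongr
        · rw [hrv, hva, Finset.sum_singleton]
          have hq : (r / a.2.2) ^ m ≤ (r / a.2.2) ^ s := by
            rw [← Real.rpow_natCast]
            exact Real.rpow_le_rpow_of_exponent_ge (by positivity) ((div_le_one h4).2 hσr) hsm.le
          calc _ ≤ c' * (κ * a.2.2 ^ s) * (r / a.2.2) ^ s := by
                gcongr
                exact (cond_ball_real_closedBall_le _ _ h4 hr.le).trans hq
            _ = c' * (κ * r ^ s) := by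
                rw [Real.div_rpow hr.le h4.le]
                have : 0 < a.2.2 ^ s := by positivity
                field_simp

theorem exists_compact_sequence {m : ℕ} {s κ D : ℝ} (hs0 : 0 ≤ s) (hsm : s < m)
    (hκ : 0 < κ) (hD : 0 ≤ D) {U : ℕ → Set (Fin m → ℝ)} {O : Set (Fin m → ℝ)} (hO : IsOpen O)
    (hcov : ∀ k, ∀ η > 0, ∀ᵐ x : Fin m → ℝ, x ∈ O → ∀ τ > 0, ∃ y ρ σ,
      0 < ρ ∧ ρ ≤ τ ∧ dist x y ≤ ρ ∧
      (0 < σ ∧ 2 * σ ≤ ρ ∧ ρ ^ m ≤ η * σ ^ s ∧ Metric.closedBall y σ ⊆ U k))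
    (μ : Measure (Fin m → ℝ)) [IsProbabilityMeasure μ] (hμ : μ ≪ volume) (hμO : μ Oᶜ = 0)
    {M : ℝ} (hM : ∀ x, ∀ r > 0, μ.real (Metric.closedBall x r) ≤ M * r ^ m)
    (hμc : ∀ x, ∀ r > 0, μ.real (Metric.closedBall x r) ≤ κ * r ^ s + D * r ^ m) :
    ∃ (K : ℕ → Set (Fin m → ℝ)) (ν : ℕ → Measure (Fin m → ℝ)),
      (∀ k, IsCompact (K k)) ∧ Antitone K ∧ (∀ k, K k ⊆ O) ∧ (∀ k, K k ⊆ U k) ∧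
      (∀ k, IsProbabilityMeasure (ν k)) ∧ (∀ k, ν k (K k)ᶜ = 0) ∧
      ∀ k x, ∀ r > 0, (ν k).real (Metric.closedBall x r) ≤ 2 * (κ * r ^ s + D * r ^ m) := by
  let Good : Set (Fin m → ℝ) × Measure (Fin m → ℝ) → Prop := fun p =>
    IsOpen p.1 ∧ p.1 ⊆ O ∧ IsProbabilityMeasure p.2 ∧ p.2 ≪ volume ∧ p.2 p.1ᶜ = 0 ∧
    (∃ M : ℝ, ∀ x, ∀ r > 0, p.2.real (Metric.closedBall x r) ≤ M * r ^ m) ∧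
    ∃ c : ℝ, 1 ≤ c ∧ c < 2 ∧
      ∀ x, ∀ r > 0, p.2.real (Metric.closedBall x r) ≤ c * (κ * r ^ s + D * r ^ m)
  have step : ∀ (p : {p // Good p}) (k : ℕ), ∃ (q : {p // Good p}) (K : Set (Fin m → ℝ)),
      IsCompact K ∧ q.1.1 ⊆ K ∧ K ⊆ p.1.1 ∧ K ⊆ U k := by
    rintro ⟨⟨O₁, μ₁⟩, h1, h2, h3, h4, h5, ⟨M₁, h6⟩, c, h7, h8, h9⟩ k
    obtain ⟨O', K', μ', M', a1, a2, a3, a4, a5, a6, a7, a8, a9, a10⟩ :=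
      exists_refined_measure (U := U k) hs0 hsm hκ hD h1
        (fun η hη => (hcov k η hη).mono fun x hx hxO => hx (h2 hxO)) μ₁ h4 h5 h6 h7
        (show c < (c + 2) / 2 by linarith) h9
    exact ⟨⟨(O', μ'), a1, a3.trans (a4.trans h2), a6, a7, a8, ⟨M', a9⟩, (c + 2) / 2,
      by linarith, by linarith, a10⟩, K', a2, a3, a4, a5⟩
  choose next K hK1 hK2 hK3 hK4 using step
  let p₀ : {p // Good p} := ⟨(O, μ), hO, subset_rfl, ‹_›, hμ, hμO, ⟨M, hM⟩, 1, le_rfl,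
    one_lt_two, by simpa using hμc⟩
  let p : ℕ → {p // Good p} := fun k => Nat.rec p₀ (fun k q => next q k) k
  have hp : ∀ k, p (k + 1) = next (p k) k := fun k => rfl
  refine ⟨fun k => K (p k) k, fun k => (p (k + 1)).1.2, fun k => hK1 _ _,
    antitone_nat_of_succ_le fun k => ?_, fun k => ?_, fun k => hK4 _ _, fun k => (p (k + 1)).2.2.2.1,
    fun k => ?_, fun k x r hr => ?_⟩
  · exact (hK3 (p (k + 1)) (k + 1)).trans (hK2 (p k) k)
  · exact (hK3 (p k) k).trans (p k).2.2.1
  · exact measure_mono_null (Set.compl_subset_compl.2 (hK2 (p k) k)) (p (k + 1)).2.2.2.2.2.1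
  · obtain ⟨c, h1, h2, h3⟩ := (p (k + 1)).2.2.2.2.2.2.2
    refine (h3 x r hr).trans ?_
    have : 0 ≤ κ * r ^ s := by positivity
    have : 0 ≤ D * r ^ m := by positivity
    gcongr

theorem le_hausdorffMeasure_iInter {m : ℕ} {s C r₀ : ℝ} (hs0 : 0 ≤ s) (hC : 0 < C) (hr₀ : 0 < r₀)
    {K : ℕ → Set (Fin m → ℝ)} {ν : ℕ → Measure (Fin m → ℝ)} (hK : ∀ k, IsCompact (K k))
    (hKanti : Antitone K) (hν : ∀ k, IsProbabilityMeasure (ν k)) (hνK : ∀ k, ν k (K k)ᶜ = 0)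
    (hνC : ∀ k x r, 0 < r → r ≤ r₀ → (ν k).real (Metric.closedBall x r) ≤ C * r ^ s) :
    (ENNReal.ofReal C)⁻¹ ≤ Measure.hausdorffMeasure s (⋂ k, K k) := by
  rw [Measure.hausdorffMeasure_apply]
  refine le_iSup₂_of_le (ENNReal.ofReal (r₀ / 2)) (by simpa using hr₀) ?_
  refine le_iInf₂ fun t hKt => le_iInf fun hdiam => ?_
  refine ENNReal.le_of_forall_pos_le_add fun e he _ => ?_
  obtain ⟨e', he', hee⟩ := ENNReal.exists_pos_sum_of_countable (ENNReal.coe_pos.2 he).ne' ℕ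
  have hrad : ∀ n, ∃ r : ℝ, 0 < r ∧ r ≤ r₀ ∧ Metric.ediam (t n) < ENNReal.ofReal r ∧
      ENNReal.ofReal r ^ s ≤ Metric.ediam (t n) ^ s + e' n := by
    intro n
    have hfin : Metric.ediam (t n) ≠ ∞ := ((hdiam n).trans_lt ENNReal.ofReal_lt_top).ne
    set d := (Metric.ediam (t n)).toReal with hd
    have hd' : Metric.ediam (t n) = ENNReal.ofReal d := (ENNReal.ofReal_toReal hfin).symm
    have hd0 : 0 ≤ d := ENNReal.toReal_nonneg
    have hdr : d < r₀ := by
      have := hdiam n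
      rw [hd', ENNReal.ofReal_le_ofReal_iff (by positivity)] at this
      linarith
    have hcont : Tendsto (fun r : ℝ => ENNReal.ofReal r ^ s) (𝓝[>] d) (𝓝 (ENNReal.ofReal d ^ s)) :=
      ((ENNReal.continuous_rpow_const.comp ENNReal.continuous_ofReal).tendsto d).mono_left
        nhdsWithin_le_nhds
    have hne : ENNReal.ofReal d ^ s ≠ ∞ := ENNReal.rpow_ne_top_of_nonneg hs0 ENNReal.ofReal_ne_top
    have hlt : ENNReal.ofReal d ^ s < ENNReal.ofReal d ^ s + e' n :=
      ENNReal.lt_add_right hne (ENNReal.coe_pos.2 (he' n)).ne'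
    obtain ⟨r, h1, h2⟩ := ((hcont.eventually (gt_mem_nhds hlt)).and
      (Ioo_mem_nhdsGT hdr)).exists
    have hr0 : 0 < r := hd0.trans_lt h2.1
    exact ⟨r, hr0, h2.2.le, by rw [hd']; exact (ENNReal.ofReal_lt_ofReal_iff hr0).2 h2.1,
      by rw [hd']; exact h1.le⟩
  choose r hr0 hrr hdr hrs using hrad
  have hx : ∀ n, ∃ x : Fin m → ℝ, (t n).Nonempty → x ∈ t n := fun n => by
    by_cases h : (t n).Nonempty
    · exact ⟨h.choose, fun _ => h.choose_spec⟩
    · exact ⟨0, fun h' => absurd h' h⟩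
  choose x hx using hx
  set V : Set (Fin m → ℝ) := ⋃ n, ⋃ _ : (t n).Nonempty, Metric.ball (x n) (r n) with hV
  have hVopen : IsOpen V := isOpen_iUnion fun n => isOpen_iUnion fun _ => Metric.isOpen_ball
  have hKV : (⋂ k, K k) ⊆ V := by
    intro z hz
    obtain ⟨n, hn⟩ := Set.mem_iUnion.1 (hKt hz)
    refine Set.mem_iUnion₂.2 ⟨n, ⟨z, hn⟩, ?_⟩
    rw [← Metric.eball_ofReal]
    exact (Metric.edist_le_ediam_of_mem hn (hx n ⟨z, hn⟩)).trans_lt (hdr n)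
  obtain ⟨k, hk⟩ := exists_subset_nhds_of_isCompact' (V := K)
    (directed_of_isDirected_le hKanti) hK (fun k => (hK k).isClosed)
    (fun z hz => hVopen.mem_nhds (hKV hz))
  have hone : 1 ≤ ν k V := by
    have h1 : ν k (K k) = 1 := (prob_compl_eq_zero_iff (hK k).isClosed.measurableSet).1 (hνK k)
    rw [← h1]; exact measure_mono hk
  have hball : ∀ n, ν k (⋃ _ : (t n).Nonempty, Metric.ball (x n) (r n))
      ≤ ENNReal.ofReal C * ((⨆ _ : (t n).Nonempty, Metric.ediam (t n) ^ s) + e' n) := by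
    intro n
    by_cases h : (t n).Nonempty
    · simp only [h, Set.iUnion_true, iSup_pos]
      calc ν k (Metric.ball (x n) (r n)) ≤ ν k (Metric.closedBall (x n) (r n)) :=
            measure_mono Metric.ball_subset_closedBall
        _ = ENNReal.ofReal ((ν k).real (Metric.closedBall (x n) (r n))) :=
            (ofReal_measureReal (measure_ne_top _ _)).symm
        _ ≤ ENNReal.ofReal (C * r n ^ s) :=
            ENNReal.ofReal_le_ofReal (hνC k (x n) (r n) (hr0 n) (hrr n))
        _ = ENNReal.ofReal C * ENNReal.ofReal (r n) ^ s := by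
            rw [ENNReal.ofReal_mul hC.le, ENNReal.ofReal_rpow_of_pos (hr0 n)]
        _ ≤ _ := by gcongr; exact hrs n
    · simp [h]
  have hsum : 1 ≤ ENNReal.ofReal C *
      ((∑' n, ⨆ _ : (t n).Nonempty, Metric.ediam (t n) ^ s) + e) := by
    calc 1 ≤ ν k V := hone
      _ ≤ ∑' n, ν k (⋃ _ : (t n).Nonempty, Metric.ball (x n) (r n)) := measure_iUnion_le _
      _ ≤ ∑' n, ENNReal.ofReal C * ((⨆ _ : (t n).Nonempty, Metric.ediam (t n) ^ s) + e' n) :=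
          ENNReal.tsum_le_tsum hball
      _ ≤ _ := by
          rw [ENNReal.tsum_mul_left, ENNReal.tsum_add]
          gcongr
  have hC0 : ENNReal.ofReal C ≠ 0 := by simpa using hC
  calc (ENNReal.ofReal C)⁻¹ = (ENNReal.ofReal C)⁻¹ * 1 := (mul_one _).symm
    _ ≤ (ENNReal.ofReal C)⁻¹ * (ENNReal.ofReal C *
      ((∑' n, ⨆ _ : (t n).Nonempty, Metric.ediam (t n) ^ s) + e)) := by gcongr
    _ = _ := by rw [← mul_assoc, ENNReal.inv_mul_cancel hC0 ENNReal.ofReal_ne_top, one_mul]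

/-- A mass transference principle: if almost every point of a set `O` of full measure in the unit
cube lies in arbitrarily small balls `B(y, ρ)` whose concentric balls `B(y, σ)`, with `ρ ^ m` much
smaller than `σ ^ s`, are contained in `U k`, then `O ∩ ⋂ k, U k` has infinite `s`-dimensional
Hausdorff measure. -/
theorem hausdorffMeasure_inter_iInter_eq_top {m : ℕ} {s : ℝ} (hs0 : 0 ≤ s) (hsm : s < m)
    {U : ℕ → Set (Fin m → ℝ)} {O : Set (Fin m → ℝ)} (hO : IsOpen O) (hO1 : volume O = 1)
    (hcov : ∀ k, ∀ η > 0, ∀ᵐ x : Fin m → ℝ, x ∈ O → ∀ τ > 0, ∃ y ρ σ,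
      0 < ρ ∧ ρ ≤ τ ∧ dist x y ≤ ρ ∧
      (0 < σ ∧ 2 * σ ≤ ρ ∧ ρ ^ m ≤ η * σ ^ s ∧ Metric.closedBall y σ ⊆ U k)) :
    Measure.hausdorffMeasure s (O ∩ ⋂ k, U k) = ∞ := by
  have hprob : IsProbabilityMeasure (volume.restrict O) := ⟨by simpa using hO1⟩
  have hM : ∀ x : Fin m → ℝ, ∀ r > 0,
      (volume.restrict O).real (Metric.closedBall x r) ≤ 2 ^ m * r ^ m := by
    intro x r hr
    rw [← mul_pow]
    refine ENNReal.toReal_le_of_le_ofReal (by positivity) ((Measure.restrict_apply_le _ _).trans ?_)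
    rw [Real.volume_pi_closedBall _ hr.le]; simp
  have key : ∀ κ > 0, (ENNReal.ofReal (4 * κ))⁻¹ ≤
      Measure.hausdorffMeasure s (O ∩ ⋂ k, U k) := by
    intro κ hκ
    obtain ⟨K, ν, h1, h2, h3, h4, h5, h6, h7⟩ := exists_compact_sequence hs0 hsm hκ
      (D := 2 ^ m) (by positivity) hO hcov (volume.restrict O)
      Measure.restrict_le_self.absolutelyContinuous
      (by rw [Measure.restrict_apply hO.measurableSet.compl]; simp) hM
      (fun x r hr => (hM x r hr).trans (le_add_of_nonneg_left (by positivity)))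
    obtain ⟨r₀, hr₀, hr₀'⟩ : ∃ r₀ > 0, ∀ r : ℝ, 0 < r → r ≤ r₀ → 2 ^ m * r ^ m ≤ κ * r ^ s := by
      have hlim : Tendsto (fun r : ℝ => 2 ^ m * r ^ ((m : ℝ) - s)) (𝓝[>] 0) (𝓝 0) := by
        have h1 : Tendsto (fun r : ℝ => r ^ ((m : ℝ) - s)) (𝓝[>] 0) (𝓝 0) := by
          have := (Real.continuousAt_rpow_const 0 ((m : ℝ) - s) (Or.inr (by linarith))).tendsto
          rw [Real.zero_rpow (by linarith)] at this
          exact this.mono_left nhdsWithin_le_nhds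
        simpa using h1.const_mul (2 ^ m)
      obtain ⟨r₁, hr₁, h⟩ := mem_nhdsGT_iff_exists_Ioc_subset.1 (hlim.eventually (gt_mem_nhds hκ))
      refine ⟨r₁, hr₁, fun r hr hrr => ?_⟩
      have h2 : 2 ^ m * r ^ ((m : ℝ) - s) < κ := h ⟨hr, hrr⟩
      calc 2 ^ m * r ^ m = 2 ^ m * r ^ ((m : ℝ) - s) * r ^ s := by
            rw [mul_assoc, ← Real.rpow_add hr, sub_add_cancel, Real.rpow_natCast]
        _ ≤ κ * r ^ s := by gcongr
    refine (le_hausdorffMeasure_iInter hs0 (by positivity) hr₀ h1 h2 h5 h6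
      fun k x r hr hrr => (h7 k x r hr).trans ?_).trans (measure_mono ?_)
    · have := hr₀' r hr hrr
      linarith
    · exact fun z hz => ⟨h3 0 (Set.mem_iInter.1 hz 0),
        Set.mem_iInter.2 fun k => h4 k (Set.mem_iInter.1 hz k)⟩
  refine ENNReal.eq_top_of_forall_nnreal_le fun C => ?_
  refine le_trans ?_ (key (4 * ((C : ℝ) + 1))⁻¹ (by positivity))
  rw [← ENNReal.ofReal_inv_of_pos (by positivity), ← ENNReal.ofReal_coe_nnreal]
  refine ENNReal.ofReal_le_ofReal ?_
  rw [mul_inv, inv_inv]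
  linarith

/-- The Chung–Erdős inequality. -/
theorem sq_sum_measureReal_le {Ω ι : Type*} [MeasurableSpace Ω] (μ : Measure Ω)
    [IsProbabilityMeasure μ] (F : Finset ι) (B : ι → Set Ω) (hB : ∀ i ∈ F, MeasurableSet (B i)) :
    (∑ i ∈ F, μ.real (B i)) ^ 2
      ≤ μ.real (⋃ i ∈ F, B i) * ∑ i ∈ F, ∑ j ∈ F, μ.real (B i ∩ B j) := by
  set G := ⋃ i ∈ F, B i with hG
  have hGm : MeasurableSet G := F.measurableSet_biUnion hB
  have hint : ∀ S : Set Ω, MeasurableSet S → Integrable (S.indicator (1 : Ω → ℝ)) μ :=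
    fun S hS => (integrable_const 1).indicator hS
  have hval : ∀ S : Set Ω, MeasurableSet S → ∫ x, S.indicator (1 : Ω → ℝ) x ∂μ = μ.real S :=
    fun S hS => integral_indicator_one hS
  have key : ∀ t : ℝ, 0 ≤ μ.real G * (t * t) + (-2 * ∑ i ∈ F, μ.real (B i)) * t +
      ∑ i ∈ F, ∑ j ∈ F, μ.real (B i ∩ B j) := by
    intro t
    have h0 : 0 ≤ ∫ x, (t * G.indicator (1 : Ω → ℝ) x -
        ∑ i ∈ F, (B i).indicator (1 : Ω → ℝ) x) ^ 2 ∂μ := integral_nonneg fun x => sq_nonneg _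
    have hexp : ∀ x, (t * G.indicator (1 : Ω → ℝ) x -
        ∑ i ∈ F, (B i).indicator (1 : Ω → ℝ) x) ^ 2 =
        t * t * G.indicator (1 : Ω → ℝ) x - 2 * t * ∑ i ∈ F, (B i).indicator (1 : Ω → ℝ) x +
        ∑ i ∈ F, ∑ j ∈ F, (B i ∩ B j).indicator (1 : Ω → ℝ) x := by
      intro x
      have h1 : ∑ i ∈ F, ∑ j ∈ F, (B i ∩ B j).indicator (1 : Ω → ℝ) x =
          (∑ i ∈ F, (B i).indicator (1 : Ω → ℝ) x) ^ 2 := by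
        rw [sq, Finset.sum_mul_sum]
        refine Finset.sum_congr rfl fun i _ => Finset.sum_congr rfl fun j _ => ?_
        rw [Set.inter_indicator_one]; rfl
      rw [h1]
      by_cases hx : x ∈ G
      · simp only [hx, Set.indicator_of_mem, Pi.one_apply]; ring
      · have : ∑ i ∈ F, (B i).indicator (1 : Ω → ℝ) x = 0 := by
          refine Finset.sum_eq_zero fun i hi => Set.indicator_of_notMem (fun h => hx ?_) _
          exact Set.mem_biUnion hi h
        rw [this]; simp [hx]
    simp_rw [hexp] at h0
    have i1 : Integrable (fun x => ∑ i ∈ F, (B i).indicator (1 : Ω → ℝ) x) μ :=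
      integrable_finsetSum _ fun i hi => hint _ (hB i hi)
    have i2 : ∀ i ∈ F, Integrable (fun x => ∑ j ∈ F, (B i ∩ B j).indicator (1 : Ω → ℝ) x) μ :=
      fun i hi => integrable_finsetSum _ fun j hj => hint _ ((hB i hi).inter (hB j hj))
    have i3 : Integrable (fun x => t * t * G.indicator (1 : Ω → ℝ) x -
        2 * t * ∑ i ∈ F, (B i).indicator (1 : Ω → ℝ) x) μ :=
      ((hint G hGm).const_mul _).sub (i1.const_mul _)
    have e1 : ∑ i ∈ F, ∫ x, (B i).indicator (1 : Ω → ℝ) x ∂μ = ∑ i ∈ F, μ.real (B i) :=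
      Finset.sum_congr rfl fun i hi => hval _ (hB i hi)
    have e2 : ∑ i ∈ F, ∫ x, ∑ j ∈ F, (B i ∩ B j).indicator (1 : Ω → ℝ) x ∂μ =
        ∑ i ∈ F, ∑ j ∈ F, μ.real (B i ∩ B j) := by
      refine Finset.sum_congr rfl fun i hi => ?_
      rw [integral_finsetSum _ (fun j hj => hint _ ((hB i hi).inter (hB j hj)))]
      exact Finset.sum_congr rfl fun j hj => hval _ ((hB i hi).inter (hB j hj))
    rw [integral_add i3 (integrable_finsetSum _ i2),
      integral_sub ((hint G hGm).const_mul _) (i1.const_mul _), integral_const_mul,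
      integral_const_mul, hval G hGm, integral_finsetSum _ (fun i hi => hint _ (hB i hi)),
      integral_finsetSum _ i2, e1, e2] at h0
    linarith
  have := discrim_le_zero key
  rw [discrim] at this
  nlinarith

theorem torus_volume_closedBall {m : ℕ} (x : Fin m → UnitAddCircle) {r : ℝ} (hr : 0 ≤ r)
    (hr' : 2 * r ≤ 1) : volume.real (Metric.closedBall x r) = (2 * r) ^ m := by
  rw [measureReal_def, closedBall_pi _ hr, volume_pi_pi]
  simp_rw [AddCircle.volume_closedBall]
  simp [min_eq_right hr', hr]

theorem torus_volume_closedBall_le {m : ℕ} (x : Fin m → UnitAddCircle) {r : ℝ} (hr : 0 ≤ r) :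
    volume.real (Metric.closedBall x r) ≤ (2 * r) ^ m := by
  rw [measureReal_def, closedBall_pi _ hr, volume_pi_pi]
  simp_rw [AddCircle.volume_closedBall]
  simp only [Finset.prod_const, Finset.card_univ, Fintype.card_fin, ENNReal.toReal_pow]
  rw [ENNReal.toReal_ofReal (by positivity)]
  gcongr
  exact min_le_right _ _

theorem torus_volume_biUnion_closedBall {m : ℕ} {ι : Type*} (F : Finset ι)
    (x : ι → Fin m → UnitAddCircle) {δ : ℝ} (hδ : 0 < δ) (hδ1 : δ ≤ 1)
    (hsep : ∀ q ∈ F, ∀ q' ∈ F, q ≠ q' → δ ≤ dist (x q) (x q')) :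
    volume.real (⋃ q ∈ F, Metric.closedBall (x q) (δ / 3)) = F.card * (2 * (δ / 3)) ^ m := by
  rw [measureReal_biUnion_finset]
  · rw [Finset.sum_congr rfl fun q _ =>
      torus_volume_closedBall (x q) (by positivity) (by linarith : 2 * (δ / 3) ≤ 1)]
    simp
  · intro q hq q' hq' hqq
    refine Metric.closedBall_disjoint_closedBall ?_
    have := hsep q hq q' hq' hqq
    linarith
  · exact fun _ _ => Metric.isClosed_closedBall.measurableSet

theorem card_mul_pow_le_of_separated {m : ℕ} {ι : Type*} (F : Finset ι)
    (x : ι → Fin m → UnitAddCircle) {δ R : ℝ} (hδ : 0 < δ) (hδ1 : δ ≤ 1) (hR : 0 ≤ R)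
    (hsep : ∀ q ∈ F, ∀ q' ∈ F, q ≠ q' → δ ≤ dist (x q) (x q'))
    (z : Fin m → UnitAddCircle) (hF : ∀ q ∈ F, dist (x q) z ≤ R) :
    F.card * δ ^ m ≤ (3 * R + δ) ^ m := by
  have h1 := torus_volume_biUnion_closedBall F x hδ hδ1 hsep
  have h2 : volume.real (⋃ q ∈ F, Metric.closedBall (x q) (δ / 3)) ≤ (2 * (R + δ / 3)) ^ m := by
    refine le_trans (measureReal_mono ?_ (measure_ne_top _ _))
      (torus_volume_closedBall_le z (by positivity))
    refine Set.iUnion₂_subset fun q hq => Metric.closedBall_subset_closedBall' ?_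
    have := hF q hq
    linarith
  rw [h1, show 2 * (δ / 3) = (2 / 3) * δ by ring, show 2 * (R + δ / 3) = (2 / 3) * (3 * R + δ) by
    ring, mul_pow, mul_pow, mul_left_comm] at h2
  exact le_of_mul_le_mul_left h2 (by positivity)

theorem sum_volume_inter_closedBall_le {m : ℕ} {ι : Type*} (F F' : Finset ι)
    (x : ι → Fin m → UnitAddCircle) {δ r r' : ℝ} (hδ : 0 < δ) (hδ1 : δ ≤ 1) (hr : 0 ≤ r)
    (hr' : 0 ≤ r') (hr'δ : r' ≤ δ / 4)
    (hsep : ∀ q ∈ F', ∀ q' ∈ F', q ≠ q' → δ ≤ dist (x q) (x q')) :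
    ∑ q ∈ F, ∑ q' ∈ F', volume.real (Metric.closedBall (x q) r ∩ Metric.closedBall (x q') r')
      ≤ 10 ^ m * (F.card * r ^ m * r' ^ m / δ ^ m + F.card * r' ^ m) := by
  classical
  have hone : ∀ q ∈ F, ∑ q' ∈ F', volume.real
      (Metric.closedBall (x q) r ∩ Metric.closedBall (x q') r')
        ≤ 10 ^ m * (r ^ m * r' ^ m / δ ^ m + r' ^ m) := by
    intro q _
    set H := F'.filter fun q' => dist (x q') (x q) ≤ r + r' with hH
    have hHF : H ⊆ F' := Finset.filter_subset _ _
    have hcard := card_mul_pow_le_of_separated H x hδ hδ1 (add_nonneg hr hr')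
      (fun a ha b hb => hsep a (hHF ha) b (hHF hb)) (x q) (fun a ha => (Finset.mem_filter.1 ha).2)
    have hmax : (3 * (r + r') + δ) ^ m ≤ 5 ^ m * (r ^ m + δ ^ m) := by
      have h1 : (3 * (r + r') + δ) ^ m ≤ (5 * max r δ) ^ m := by
        gcongr
        have := le_max_left r δ
        have := le_max_right r δ
        linarith
      refine h1.trans ?_
      rw [mul_pow]
      gcongr
      rcases max_choice r δ with h | h <;> rw [h]
      · exact le_add_of_nonneg_right (by positivity)
      · exact le_add_of_nonneg_left (by positivity)
    have hcard' : (H.card : ℝ) ≤ 5 ^ m * (r ^ m + δ ^ m) / δ ^ m := by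
      rw [le_div_iff₀ (by positivity)]
      exact hcard.trans hmax
    calc ∑ q' ∈ F', volume.real (Metric.closedBall (x q) r ∩ Metric.closedBall (x q') r')
        = ∑ q' ∈ H, volume.real (Metric.closedBall (x q) r ∩ Metric.closedBall (x q') r') := by
          refine (Finset.sum_subset hHF fun a ha haH => ?_).symm
          have : Metric.closedBall (x q) r ∩ Metric.closedBall (x a) r' = ∅ := by
            rw [← Set.disjoint_iff_inter_eq_empty]
            refine Metric.closedBall_disjoint_closedBall ?_
            by_contra h
            exact haH (Finset.mem_filter.2 ⟨ha, by rw [dist_comm]; exact not_lt.1 h⟩)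
          rw [this, measureReal_empty]
      _ ≤ ∑ q' ∈ H, (2 * r') ^ m := by
          refine Finset.sum_le_sum fun a _ => ?_
          exact (measureReal_mono Set.inter_subset_right (measure_ne_top _ _)).trans
            (torus_volume_closedBall_le _ hr')
      _ = H.card * (2 * r') ^ m := by simp
      _ ≤ (5 ^ m * (r ^ m + δ ^ m) / δ ^ m) * (2 * r') ^ m := by gcongr
      _ = 10 ^ m * (r ^ m * r' ^ m / δ ^ m + r' ^ m) := by
          rw [show (10 : ℝ) = 5 * 2 by norm_num, mul_pow, mul_pow]
          field_simp
  refine (Finset.sum_le_sum hone).trans (le_of_eq ?_)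
  rw [Finset.sum_const, nsmul_eq_mul]
  ring

instance isProbabilityMeasure_volume_torus {m : ℕ} :
    IsProbabilityMeasure (volume : Measure (Fin m → UnitAddCircle)) :=
  ⟨by rw [← Set.pi_univ Set.univ, volume_pi_pi]; simp⟩

theorem sum_half_pow_le_two (S : Finset ℕ) (i : ℕ) :
    ∑ j ∈ S, (if j ≤ i then (1 / 2 : ℝ) ^ (i - j) else 0) ≤ 2 := by
  rw [← Finset.sum_filter]
  calc ∑ j ∈ S with j ≤ i, (1 / 2 : ℝ) ^ (i - j)
      ≤ ∑ j ∈ Finset.range (i + 1), (1 / 2 : ℝ) ^ (i - j) := by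
        refine Finset.sum_le_sum_of_subset_of_nonneg (fun j hj => ?_) fun _ _ _ => by positivity
        rw [Finset.mem_filter] at hj
        exact Finset.mem_range.2 (by omega)
    _ = ∑ j ∈ Finset.range (i + 1), (1 / 2 : ℝ) ^ j := by
        rw [← Finset.sum_range_reflect]
        refine Finset.sum_congr rfl fun j hj => ?_
        congr 1
        have := Finset.mem_range.1 hj
        omega
    _ ≤ 2 := sum_geometric_two_le _

theorem mul_pow_le_of_two_mul_le {N : ℕ → ℝ} (hN : ∀ i, 2 * N i ≤ N (i + 1)) {i j : ℕ}
    (hij : i ≤ j) : N i ≤ (1 / 2) ^ (j - i) * N j := by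
  induction j, hij using Nat.le_induction with
  | base => simp
  | succ j hij ih =>
    rw [Nat.succ_sub hij, pow_succ]
    have := mul_le_mul_of_nonneg_left (hN j) (by positivity : (0 : ℝ) ≤ (1 / 2) ^ (j - i))
    linarith

/-- Second moment bound for a block of separated families of balls. -/
theorem sum_sq_le_volume_biUnion_mul {m : ℕ} {ι : Type*} (Q : ℕ → Finset ι)
    (x : ι → Fin m → UnitAddCircle) {φ δ : ℕ → ℝ} {c : ℝ} (hc : 0 < c)
    (hφ : ∀ i, 0 < φ i) (hφδ : ∀ i, φ i ≤ δ i / 4) (hδ1 : ∀ i, δ i ≤ 1)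
    (hsep : ∀ i, ∀ q ∈ Q i, ∀ q' ∈ Q i, q ≠ q' → δ i ≤ dist (x q) (x q'))
    (hcard : ∀ i, (Q i).card * δ i ^ m = c)
    (hdouble : ∀ i, 2 * ((Q i).card : ℝ) ≤ (Q (i + 1)).card) (S : Finset ℕ) :
    4 ^ m * (∑ i ∈ S, (Q i).card * φ i ^ m) ^ 2 ≤
      volume.real (⋃ i ∈ S, ⋃ q ∈ Q i, Metric.closedBall (x q) (φ i)) *
        (10 ^ m * ((∑ i ∈ S, (Q i).card * φ i ^ m) ^ 2 / c +
          4 * ∑ i ∈ S, (Q i).card * φ i ^ m)) := by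
  have hδ : ∀ i, 0 < δ i := fun i => by linarith [hφ i, hφδ i]
  set a : ℕ → ℝ := fun i => (Q i).card * φ i ^ m with ha
  have ha0 : ∀ i, 0 ≤ a i := fun i => mul_nonneg (Nat.cast_nonneg _) (pow_nonneg (hφ i).le _)
  set e : ℕ → ℕ → ℝ := fun i j => if j ≤ i then (1 / 2 : ℝ) ^ (i - j) else 0 with he
  have he0 : ∀ i j, 0 ≤ e i j := fun i j => by
    simp only [he]; split_ifs <;> positivity
  have hcross : ∀ i j, i ≤ j → ∑ q ∈ Q i, ∑ q' ∈ Q j,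
      volume.real (Metric.closedBall (x q) (φ i) ∩ Metric.closedBall (x q') (φ j)) ≤
        10 ^ m * (a i * a j / c + e j i * a j) := by
    intro i j hij
    refine (sum_volume_inter_closedBall_le (Q i) (Q j) x (hδ j) (hδ1 j) (hφ i).le (hφ j).le
      (hφδ j) (hsep j)).trans ?_
    have hδj : δ j ^ m ≠ 0 := (pow_pos (hδ j) m).ne'
    have h1 : (Q i).card * φ i ^ m * φ j ^ m / δ j ^ m = a i * a j / c := by
      rw [← hcard j]
      have : ((Q j).card : ℝ) ≠ 0 := by
        intro h
        have := hcard j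
        rw [h, zero_mul] at this
        exact hc.ne this
      simp only [ha]
      field_simp
    have h2 : (Q i).card * φ j ^ m ≤ e j i * a j := by
      simp only [he, ha, if_pos hij]
      rw [← mul_assoc]
      exact mul_le_mul_of_nonneg_right
        (mul_pow_le_of_two_mul_le (N := fun i => ((Q i).card : ℝ)) hdouble hij)
        (pow_nonneg (hφ j).le _)
    rw [h1]
    gcongr
  have hcross' : ∀ i j, ∑ q ∈ Q i, ∑ q' ∈ Q j,
      volume.real (Metric.closedBall (x q) (φ i) ∩ Metric.closedBall (x q') (φ j)) ≤
        10 ^ m * (a i * a j / c + e j i * a j + e i j * a i) := by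
    intro i j
    rcases le_total i j with hij | hij
    · refine (hcross i j hij).trans (mul_le_mul_of_nonneg_left ?_ (by positivity))
      exact le_add_of_nonneg_right (mul_nonneg (he0 _ _) (ha0 _))
    · rw [Finset.sum_comm]
      simp_rw [Set.inter_comm (Metric.closedBall (x _) (φ i))]
      refine (hcross j i hij).trans ?_
      gcongr
      have := mul_nonneg (he0 j i) (ha0 j)
      rw [mul_comm (a j)]
      linarith
  have hCE := sq_sum_measureReal_le (volume : Measure (Fin m → UnitAddCircle)) (S.sigma Q)
    (fun p => Metric.closedBall (x p.2) (φ p.1)) fun _ _ => Metric.isClosed_closedBall.measurableSet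
  have hA : ∑ p ∈ S.sigma Q, volume.real (Metric.closedBall (x p.2) (φ p.1)) =
      2 ^ m * ∑ i ∈ S, a i := by
    rw [Finset.sum_sigma, Finset.mul_sum]
    refine Finset.sum_congr rfl fun i _ => ?_
    simp only
    rw [Finset.sum_congr rfl fun q _ => torus_volume_closedBall (x q) (hφ i).le
      (by linarith [hφδ i, hδ1 i])]
    rw [Finset.sum_const, nsmul_eq_mul, mul_pow]
    simp only [ha]
    ring
  have hG : (⋃ p ∈ S.sigma Q, Metric.closedBall (x p.2) (φ p.1)) =
      ⋃ i ∈ S, ⋃ q ∈ Q i, Metric.closedBall (x q) (φ i) := by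
    ext b
    simp only [Set.mem_iUnion, Finset.mem_sigma]
    constructor
    · rintro ⟨p, ⟨h1, h2⟩, h3⟩
      exact ⟨p.1, h1, p.2, h2, h3⟩
    · rintro ⟨i, h1, q, h2, h3⟩
      exact ⟨⟨i, q⟩, ⟨h1, h2⟩, h3⟩
  rw [hA, hG] at hCE
  have hsq : (2 ^ m * ∑ i ∈ S, a i) ^ 2 = 4 ^ m * (∑ i ∈ S, a i) ^ 2 := by
    rw [mul_pow, ← pow_mul, mul_comm m 2, pow_mul]; norm_num
  rw [hsq] at hCE
  refine hCE.trans (mul_le_mul_of_nonneg_left ?_ measureReal_nonneg)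
  have he2 : ∑ i ∈ S, ∑ j ∈ S, e i j * a i ≤ 2 * ∑ i ∈ S, a i := by
    rw [Finset.mul_sum]
    refine Finset.sum_le_sum fun i _ => ?_
    rw [← Finset.sum_mul]
    exact mul_le_mul_of_nonneg_right (sum_half_pow_le_two S i) (ha0 i)
  calc ∑ p ∈ S.sigma Q, ∑ p' ∈ S.sigma Q, volume.real
        (Metric.closedBall (x p.2) (φ p.1) ∩ Metric.closedBall (x p'.2) (φ p'.1))
      = ∑ i ∈ S, ∑ j ∈ S, ∑ q ∈ Q i, ∑ q' ∈ Q j,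
        volume.real (Metric.closedBall (x q) (φ i) ∩ Metric.closedBall (x q') (φ j)) := by
        rw [Finset.sum_sigma]
        refine Finset.sum_congr rfl fun i _ => ?_
        simp_rw [Finset.sum_sigma]
        rw [Finset.sum_comm]
    _ ≤ ∑ i ∈ S, ∑ j ∈ S, 10 ^ m * (a i * a j / c + e j i * a j + e i j * a i) :=
        Finset.sum_le_sum fun i _ => Finset.sum_le_sum fun j _ => hcross' i j
    _ = 10 ^ m * ((∑ i ∈ S, a i) ^ 2 / c + (∑ i ∈ S, ∑ j ∈ S, e j i * a j) +
          ∑ i ∈ S, ∑ j ∈ S, e i j * a i) := by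
        rw [sq, Finset.sum_mul_sum, Finset.sum_div]
        simp_rw [Finset.sum_div, ← Finset.mul_sum, ← Finset.sum_add_distrib]
    _ ≤ _ := by
        rw [Finset.sum_comm (f := fun i j => e j i * a j)]
        refine mul_le_mul_of_nonneg_left ?_ (by positivity)
        linarith

/-- A limsup set of separated families of balls with divergent volume sum has positive measure. -/
theorem volume_limsup_closedBall_pos {m : ℕ} {ι : Type*} (Q : ℕ → Finset ι)
    (x : ι → Fin m → UnitAddCircle) {φ δ : ℕ → ℝ} {c : ℝ} (hc : 0 < c)
    (hφ : ∀ i, 0 < φ i) (hφδ : ∀ i, φ i ≤ δ i / 4) (hδ1 : ∀ i, δ i ≤ 1)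
    (hsep : ∀ i, ∀ q ∈ Q i, ∀ q' ∈ Q i, q ≠ q' → δ i ≤ dist (x q) (x q'))
    (hcard : ∀ i, (Q i).card * δ i ^ m = c)
    (hdouble : ∀ i, 2 * ((Q i).card : ℝ) ≤ (Q (i + 1)).card)
    (hdiv : ¬ Summable fun i => (Q i).card * φ i ^ m) :
    volume (⋂ I : ℕ, ⋃ i, ⋃ (_ : I ≤ i), ⋃ q ∈ Q i, Metric.closedBall (x q) (φ i)) ≠ 0 := by
  set a : ℕ → ℝ := fun i => (Q i).card * φ i ^ m with ha
  have ha0 : ∀ i, 0 ≤ a i := fun i => mul_nonneg (Nat.cast_nonneg _) (pow_nonneg (hφ i).le _)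
  set β : ℝ := 4 ^ m / (10 ^ m * (1 / c + 4)) with hβ
  have hβ0 : 0 < β := by positivity
  set W : ℕ → Set (Fin m → UnitAddCircle) :=
    fun I => ⋃ i, ⋃ (_ : I ≤ i), ⋃ q ∈ Q i, Metric.closedBall (x q) (φ i) with hW
  have hWβ : ∀ I, ENNReal.ofReal β ≤ volume (W I) := by
    intro I
    have hI : ¬ Summable fun i => a (i + I) := fun h => hdiv ((summable_nat_add_iff I).1 h)
    obtain ⟨J, hJ⟩ := ((not_summable_iff_tendsto_nat_atTop_of_nonneg fun i => ha0 (i + I)).1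
      hI).eventually_ge_atTop 1 |>.exists
    set S := (Finset.range J).image (· + I) with hS
    have hsum : ∑ i ∈ S, a i = ∑ i ∈ Finset.range J, a (i + I) :=
      Finset.sum_image fun _ _ _ _ h => Nat.add_right_cancel h
    have key := sum_sq_le_volume_biUnion_mul Q x hc hφ hφδ hδ1 hsep hcard hdouble S
    set A := ∑ i ∈ S, a i with hA
    have hA1 : 1 ≤ A := by rw [hsum]; exact hJ
    set G := ⋃ i ∈ S, ⋃ q ∈ Q i, Metric.closedBall (x q) (φ i) with hG
    have hGW : G ⊆ W I := by
      refine Set.iUnion₂_subset fun i hi => ?_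
      obtain ⟨k, -, rfl⟩ := Finset.mem_image.1 hi
      exact Set.subset_iUnion₂_of_subset (k + I) (Nat.le_add_left _ _) subset_rfl
    have hb : β ≤ volume.real G := by
      clear_value A G
      rw [hβ, div_le_iff₀ (by positivity)]
      have h1 : volume.real G * (10 ^ m * (A ^ 2 / c + 4 * A)) ≤
          volume.real G * (10 ^ m * (1 / c + 4)) * A ^ 2 := by
        have : A ^ 2 / c + 4 * A ≤ (1 / c + 4) * A ^ 2 := by
          have : A ≤ A ^ 2 := by nlinarith
          have h : (1 / c + 4) * A ^ 2 = A ^ 2 / c + 4 * A ^ 2 := by ring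
          linarith
        rw [mul_assoc, mul_assoc]
        refine mul_le_mul_of_nonneg_left ?_ measureReal_nonneg
        exact mul_le_mul_of_nonneg_left this (by positivity)
      exact le_of_mul_le_mul_right (key.trans h1) (by positivity)
    calc ENNReal.ofReal β ≤ ENNReal.ofReal (volume.real G) := ENNReal.ofReal_le_ofReal hb
      _ = volume G := ofReal_measureReal (measure_ne_top _ _)
      _ ≤ volume (W I) := measure_mono hGW
  have hlim := tendsto_measure_iInter_atTop (μ := (volume : Measure (Fin m → UnitAddCircle)))
    (s := W) (fun I => MeasurableSet.nullMeasurableSet <| MeasurableSet.iUnion fun i =>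
      MeasurableSet.iUnion fun _ => (Q i).measurableSet_biUnion fun _ _ =>
        Metric.isClosed_closedBall.measurableSet)
    (fun I J hIJ => Set.iUnion_mono fun i => Set.iUnion_mono' fun h => ⟨hIJ.trans h, subset_rfl⟩)
    ⟨0, measure_ne_top _ _⟩
  have := ge_of_tendsto' hlim hWβ
  exact fun h => (ENNReal.ofReal_pos.2 hβ0).not_ge (h ▸ this)

theorem dense_range_of_separated {m : ℕ} {G : Type*} [AddGroup G]
    (x : G →+ (Fin m → UnitAddCircle)) (Q : ℕ → Finset G) {δ : ℕ → ℝ} {c : ℝ} (hc : 0 < c)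
    (hδ : ∀ i, 0 < δ i) (hδ1 : ∀ i, δ i ≤ 1) (hδ0 : Tendsto δ atTop (𝓝 0))
    (hsep : ∀ i, ∀ q ∈ Q i, ∀ q' ∈ Q i, q ≠ q' → δ i ≤ dist (x q) (x q'))
    (hcard : ∀ i, (Q i).card * δ i ^ m = c) : Dense (Set.range x) := by
  set H : AddSubgroup (Fin m → UnitAddCircle) := x.range.topologicalClosure with hH
  have hHc : IsClosed (H : Set (Fin m → UnitAddCircle)) :=
    AddSubgroup.isClosed_topologicalClosure _
  have hmem : ∀ q, x q ∈ (H : Set (Fin m → UnitAddCircle)) := fun q =>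
    AddSubgroup.le_topologicalClosure _ ⟨q, rfl⟩
  have hlow : ∀ i, ENNReal.ofReal (c * (2 / 3) ^ m) ≤
      volume (Metric.cthickening (δ i) (H : Set (Fin m → UnitAddCircle))) := by
    intro i
    have h1 := torus_volume_biUnion_closedBall (Q i) x (hδ i) (hδ1 i) (hsep i)
    have h2 : ((Q i).card : ℝ) * (2 * (δ i / 3)) ^ m = c * (2 / 3) ^ m := by
      rw [← hcard i, show 2 * (δ i / 3) = δ i * (2 / 3) by ring, mul_pow, mul_assoc]
    rw [← h2, ← h1, ofReal_measureReal (measure_ne_top _ _)]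
    refine measure_mono (Set.iUnion₂_subset fun q _ b hb => ?_)
    refine Metric.mem_cthickening_of_dist_le b (x q) _ _ (hmem q) ?_
    have := Metric.mem_closedBall.1 hb
    linarith [hδ i]
  have hlim := (tendsto_measure_cthickening_of_isClosed
    (μ := (volume : Measure (Fin m → UnitAddCircle))) ⟨1, one_pos, measure_ne_top _ _⟩ hHc).comp hδ0
  have hpos : 0 < volume (H : Set (Fin m → UnitAddCircle)) :=
    (ENNReal.ofReal_pos.2 (by positivity)).trans_le (ge_of_tendsto' hlim hlow)
  have hnhds := Measure.sub_mem_nhds_zero_of_addHaar_pos_ne_top volume _ hHc.measurableSet hpos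
    (measure_ne_top _ _)
  have hopen : IsOpen (H : Set (Fin m → UnitAddCircle)) := by
    refine AddSubgroup.isOpen_of_mem_nhds H (g := 0) (mem_of_superset hnhds ?_)
    rintro _ ⟨a, ha, b, hb, rfl⟩
    exact H.sub_mem ha hb
  have huniv : (H : Set (Fin m → UnitAddCircle)) = Set.univ :=
    IsClopen.eq_univ ⟨hHc, hopen⟩ ⟨0, H.zero_mem⟩
  rw [dense_iff_closure_eq, ← huniv, hH, AddSubgroup.topologicalClosure_coe]
  rfl

/-- Translating a non-null set by a dense subgroup covers almost everything. -/
theorem ae_exists_sub_mem_of_dense {G M : Type*} [AddCommGroup G] [Countable G] [AddCommGroup M]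
    [TopologicalSpace M] [IsTopologicalAddGroup M] [R1Space M] [SecondCountableTopology M]
    [MeasurableSpace M] [BorelSpace M] {μ : Measure M} [IsFiniteMeasure μ] [μ.InnerRegular]
    [μ.IsAddLeftInvariant] (x : G →+ M) (hx : Dense (Set.range x))
    {V : Set M} (hV : MeasurableSet V) (hV0 : μ V ≠ 0) : ∀ᵐ b ∂μ, ∃ q, b - x q ∈ V := by
  set Y : Set M := ⋃ q, (fun b => b - x q) ⁻¹' V with hY
  have hYm : MeasurableSet Y := MeasurableSet.iUnion fun q => (measurable_sub_const _) hV
  have hinv : ∀ g ∈ Set.range x, (g +ᵥ ·) ⁻¹' Y = Y := by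
    rintro _ ⟨q₀, rfl⟩
    ext b
    simp only [hY, Set.mem_preimage, Set.mem_iUnion, vadd_eq_add]
    constructor
    · rintro ⟨q, h⟩
      exact ⟨q - q₀, by rwa [map_sub, sub_sub_eq_add_sub, add_comm b]⟩
    · rintro ⟨q, h⟩
      exact ⟨q + q₀, by rwa [map_add, add_comm (x q₀), add_sub_add_right_eq_sub]⟩
  have hconst : EventuallyConst Y (ae μ) :=
    aeconst_of_dense_setOfPred_preimage_vadd_eq hYm.nullMeasurableSet (hx.mono hinv)
  have hY0 : μ Y ≠ 0 := fun h => hV0 <| measure_mono_null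
    (Set.subset_iUnion_of_subset 0 (by simp)) h
  rcases eventuallyConst_set.1 hconst with h | h
  · filter_upwards [h] with b hb
    simpa [hY] using hb
  · exact absurd (measure_eq_zero_iff_ae_notMem.2 h) hY0

theorem not_summable_min {a : ℕ → ℝ} (ha : ¬ Summable a) {k c : ℝ} (hk : 0 < k) (hc : 0 < c) :
    ¬ Summable fun i => min (k * a i) c := by
  intro h
  refine ha ((summable_mul_left_iff hk.ne').1 ((summable_congr_atTop ?_).1 h))
  filter_upwards [h.tendsto_atTop_zero.eventually_lt_const hc] with i hi
  exact min_eq_left (((min_lt_iff.1 hi).resolve_right (lt_irrefl _)).le)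

/-- Divergence part of the twisted Khintchine theorem along a return sequence, on the torus. -/
theorem ae_infinite_dist_lt {m n : ℕ} (hm : 0 < m) (hn : 0 < n)
    (x : (Fin n → ℤ) →+ (Fin m → UnitAddCircle)) {ε : ℝ} (hε : 0 < ε) {ℓ : ℕ → ℕ}
    (hℓ : StrictMono ℓ) (hℓ1 : ∀ i, 1 ≤ ℓ i)
    (hret : ∀ i, ∀ q : Fin n → ℤ, q ≠ 0 → ‖(fun j => (q j : ℝ))‖ < 2 ^ ℓ i →
      ε * (2 : ℝ) ^ (-(n : ℝ) * ℓ i / m) ≤ ‖x q‖)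
    {φ : ℝ → ℝ} (hφ : ∀ r, 0 < r → 0 < φ r) (hφa : ∀ r t, 0 < r → r ≤ t → φ t ≤ φ r)
    (hdiv : ¬ Summable fun i => (2 : ℝ) ^ (ℓ i * n) * φ (2 ^ ℓ i) ^ m) :
    ∀ᵐ b : Fin m → UnitAddCircle,
      {q : Fin n → ℤ | dist (x q) b < φ ‖(fun j => (q j : ℝ))‖}.Infinite := by
  have hm' : (m : ℝ) ≠ 0 := by positivity
  set ε' := min ε 1 with hε'
  have hε'0 : 0 < ε' := lt_min hε one_pos
  set Q : ℕ → Finset (Fin n → ℤ) :=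
    fun i => Fintype.piFinset fun _ => Finset.Ico 0 (2 ^ (ℓ i - 1)) with hQ
  set δ : ℕ → ℝ := fun i => ε' * (2 : ℝ) ^ (-(n : ℝ) * ℓ i / m) with hδ
  set f : ℕ → ℝ := fun i => min (φ (2 ^ ℓ i) / 2) (δ i / 4) with hf
  have hδ0 : ∀ i, 0 < δ i := fun i => by positivity
  have hδ1 : ∀ i, δ i ≤ 1 := fun i => by
    refine mul_le_one₀ (min_le_right _ _) (by positivity) ?_
    refine Real.rpow_le_one_of_one_le_of_nonpos one_le_two ?_
    rw [neg_mul, neg_div]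
    exact neg_nonpos.2 (by positivity)
  have hδm : ∀ i, δ i ^ m = ε' ^ m * ((2 : ℝ) ^ (ℓ i * n))⁻¹ := fun i => by
    simp only [hδ]
    rw [mul_pow, ← Real.rpow_natCast ((2 : ℝ) ^ _) m, ← Real.rpow_mul zero_le_two,
      div_mul_cancel₀ _ hm', neg_mul, Real.rpow_neg zero_le_two, mul_comm (n : ℝ)]
    congr 2
    exact_mod_cast Real.rpow_natCast 2 (ℓ i * n)
  have hpow : ∀ i, (2 : ℝ) ^ (ℓ i * n) = 2 ^ n * ((Q i).card : ℝ) := fun i => by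
    simp only [hQ, Fintype.card_piFinset, Int.card_Ico, sub_zero, Finset.prod_const,
      Finset.card_univ, Fintype.card_fin]
    have : ((2 : ℤ) ^ (ℓ i - 1)).toNat = 2 ^ (ℓ i - 1) := by
      rw [show (2 : ℤ) ^ (ℓ i - 1) = ((2 ^ (ℓ i - 1) : ℕ) : ℤ) by push_cast; rfl, Int.toNat_natCast]
    rw [this]
    push_cast
    rw [← mul_pow, ← pow_succ', Nat.sub_add_cancel (hℓ1 i), pow_mul]
  have hℓt : Tendsto ℓ atTop atTop := hℓ.tendsto_atTop
  have hδt : Tendsto δ atTop (𝓝 0) := by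
    have h1 : Tendsto (fun i => -(n : ℝ) * ℓ i / m) atTop atBot := by
      have : Tendsto (fun i => (n : ℝ) / m * ℓ i) atTop atTop :=
        (tendsto_natCast_atTop_atTop.comp hℓt).const_mul_atTop (by positivity)
      refine (tendsto_neg_atTop_atBot.comp this).congr fun i => ?_
      simp only [Function.comp]
      ring
    have h2 := (tendsto_rpow_atBot_of_base_gt_one 2 one_lt_two).comp h1
    simpa only [mul_zero] using! h2.const_mul ε'
  have hf0 : ∀ i, 0 < f i := fun i => lt_min (half_pos (hφ _ (by positivity))) (by linarith [hδ0 i])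
  have hft : Tendsto f atTop (𝓝 0) :=
    squeeze_zero (fun i => (hf0 i).le) (fun i => min_le_right _ _) (by simpa using hδt.div_const 4)
  have hsep : ∀ i, ∀ q ∈ Q i, ∀ q' ∈ Q i, q ≠ q' → δ i ≤ dist (x q) (x q') := by
    intro i q hq q' hq' hne
    rw [dist_eq_norm, ← map_sub]
    refine le_trans ?_ (hret i (q - q') (sub_ne_zero.2 hne) ?_)
    · exact mul_le_mul_of_nonneg_right (min_le_left _ _) (by positivity)
    · rw [pi_norm_lt_iff (by positivity)]
      intro j
      have h1 := Finset.mem_Ico.1 (Fintype.mem_piFinset.1 hq j)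
      have h2 := Finset.mem_Ico.1 (Fintype.mem_piFinset.1 hq' j)
      have h3 : (2 : ℤ) ^ (ℓ i - 1) ≤ 2 ^ ℓ i := pow_le_pow_right₀ one_le_two (Nat.sub_le _ _)
      have h4 : |q j - q' j| < 2 ^ ℓ i := abs_lt.2 ⟨by linarith, by linarith⟩
      rw [Real.norm_eq_abs, Pi.sub_apply]
      exact_mod_cast h4
  have hcard : ∀ i, (Q i).card * δ i ^ m = ε' ^ m / 2 ^ n := fun i => by
    have h : ((Q i).card : ℝ) ≠ 0 := fun h => by
      have := hpow i
      rw [h, mul_zero] at this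
      exact absurd this (by positivity)
    rw [hδm, hpow]
    field_simp
  have hdouble : ∀ i, 2 * ((Q i).card : ℝ) ≤ (Q (i + 1)).card := fun i => by
    have h1 := hpow i
    have h2 := hpow (i + 1)
    have h3 : (2 : ℝ) * 2 ^ (ℓ i * n) ≤ 2 ^ (ℓ (i + 1) * n) := by
      rw [← pow_succ']
      refine pow_le_pow_right₀ one_le_two ?_
      have := Nat.mul_le_mul_right n (Nat.succ_le_of_lt (hℓ (Nat.lt_succ_self i)))
      rw [Nat.succ_mul] at this
      exact (Nat.add_le_add_left hn _).trans this
    rw [h1, h2, mul_left_comm] at h3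
    exact le_of_mul_le_mul_left h3 (by positivity)
  have hdiv' : ¬ Summable fun i => (Q i).card * f i ^ m := by
    have := not_summable_min hdiv (k := (2 ^ n * 2 ^ m)⁻¹) (c := ε' ^ m / 2 ^ n / 4 ^ m)
      (by positivity) (by positivity)
    refine (summable_congr fun i => ?_).not.2 this
    have hmin : f i ^ m = min ((φ (2 ^ ℓ i) / 2) ^ m) ((δ i / 4) ^ m) := by
      have h1 : 0 ≤ φ (2 ^ ℓ i) / 2 := (half_pos (hφ _ (by positivity))).le
      have h2 : 0 ≤ δ i / 4 := by linarith [hδ0 i]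
      rcases le_total (φ (2 ^ ℓ i) / 2) (δ i / 4) with h | h
      · simp only [hf]
        rw [min_eq_left h, min_eq_left (pow_le_pow_left₀ h1 h m)]
      · simp only [hf]
        rw [min_eq_right h, min_eq_right (pow_le_pow_left₀ h2 h m)]
    rw [hmin, mul_min_of_nonneg _ _ (Nat.cast_nonneg _), div_pow, div_pow, ← mul_div_assoc (b := δ i ^ m),
      hcard, hpow]
    congr 1
    field_simp
  have hdense := dense_range_of_separated x Q (by positivity) hδ0 hδ1 hδt hsep hcard
  have hpos := volume_limsup_closedBall_pos Q x (φ := f) (by positivity) hf0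
    (fun i => min_le_right _ _) hδ1 hsep hcard hdouble hdiv'
  have hVm : MeasurableSet (⋂ I : ℕ, ⋃ i, ⋃ (_ : I ≤ i), ⋃ q ∈ Q i,
      Metric.closedBall (x q) (f i)) :=
    MeasurableSet.iInter fun I => MeasurableSet.iUnion fun i => MeasurableSet.iUnion fun _ =>
      (Q i).measurableSet_biUnion fun _ _ => Metric.isClosed_closedBall.measurableSet
  have hae := ae_exists_sub_mem_of_dense x hdense hVm hpos
  have : NullSingletonClass (volume : Measure (Fin m → UnitAddCircle)) := ⟨fun b => by
    have h := torus_volume_closedBall b le_rfl (by norm_num)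
    rw [Metric.closedBall_zero, mul_zero, zero_pow hm.ne'] at h
    exact (measureReal_eq_zero_iff (measure_ne_top _ _)).1 h⟩
  have hctble : ∀ᵐ b : Fin m → UnitAddCircle, b ∉ Set.range x :=
    measure_eq_zero_iff_ae_notMem.1 ((Set.countable_range x).measure_zero _)
  filter_upwards [hae, hctble] with b ⟨q₀, hb⟩ hbx hfin
  set F : Finset (Fin n → ℤ) := insert 0 hfin.toFinset with hF
  obtain ⟨q₁, -, hq₁⟩ := F.exists_min_image (fun q => dist (x q) b) ⟨0, Finset.mem_insert_self _ _⟩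
  have hd : 0 < dist (x q₁) b := dist_pos.2 fun h => hbx ⟨q₁, h⟩
  have hlarge : ∀ᶠ i in atTop, ‖(fun j => (q₀ j : ℝ))‖ ≤ 2 ^ (ℓ i - 1) := by
    have h1 : Tendsto (fun i => ℓ i - 1) atTop atTop := (tendsto_sub_atTop_nat 1).comp hℓt
    exact ((tendsto_pow_atTop_atTop_of_one_lt (one_lt_two (α := ℝ))).comp h1).eventually_ge_atTop _
  obtain ⟨I, hI⟩ := ((hft.eventually_lt_const hd).and hlarge).exists_forall_of_atTop
  have hbI := Set.mem_iInter.1 hb I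
  simp only [Set.mem_iUnion] at hbI
  obtain ⟨i, hiI, q, hq, hbq⟩ := hbI
  obtain ⟨hfi, hqi⟩ := hI i hiI
  have hdist : dist (x (q + q₀)) b ≤ f i := by
    rw [Metric.mem_closedBall, dist_eq_norm] at hbq
    rw [dist_comm, dist_eq_norm, map_add, add_comm, ← sub_sub]
    exact hbq
  by_cases hqF : q + q₀ ∈ F
  · exact absurd (hq₁ _ hqF) (not_le.2 (hdist.trans_lt hfi))
  · rw [hF, Finset.mem_insert, not_or, Set.Finite.mem_toFinset, Set.mem_ofPred] at hqF
    refine hqF.2 ?_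
    have hnorm0 : 0 < ‖(fun j => ((q + q₀) j : ℝ))‖ := by
      rw [norm_pos_iff]
      intro h
      exact hqF.1 (funext fun j => Int.cast_eq_zero.1 (congrFun h j))
    have hnorm : ‖(fun j => ((q + q₀) j : ℝ))‖ ≤ 2 ^ ℓ i := by
      have h1 : (2 : ℝ) ^ ℓ i = 2 ^ (ℓ i - 1) + 2 ^ (ℓ i - 1) := by
        rw [← two_mul, ← pow_succ', Nat.sub_add_cancel (hℓ1 i)]
      rw [h1, pi_norm_le_iff_of_nonneg (by positivity)]
      intro j
      have h2 := Finset.mem_Ico.1 (Fintype.mem_piFinset.1 hq j)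
      have h3 := (norm_le_pi_norm (fun j => (q₀ j : ℝ)) j).trans hqi
      rw [Pi.add_apply, Int.cast_add]
      refine (norm_add_le _ _).trans (add_le_add ?_ h3)
      rw [Real.norm_eq_abs, abs_of_nonneg (by exact_mod_cast h2.1)]
      exact_mod_cast h2.2.le
    calc dist (x (q + q₀)) b ≤ f i := hdist
      _ ≤ φ (2 ^ ℓ i) / 2 := min_le_left _ _
      _ < φ (2 ^ ℓ i) := half_lt_self (hφ _ (by positivity))
      _ ≤ _ := hφa _ _ hnorm0 hnorm

theorem bddBelow_range_norm_sub_intCast {k : ℕ} (x : Fin k → ℝ) :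
    BddBelow (Set.range fun p : Fin k → ℤ => ‖x - (fun i => (p i : ℝ))‖) :=
  ⟨0, by rintro _ ⟨p, rfl⟩; exact norm_nonneg _⟩

theorem intDist_le_norm_sub {k : ℕ} (x : Fin k → ℝ) (p : Fin k → ℤ) :
    intDist x ≤ ‖x - (fun i => (p i : ℝ))‖ :=
  ciInf_le (bddBelow_range_norm_sub_intCast x) p

theorem norm_torus_le_intDist {k : ℕ} (x : Fin k → ℝ) :
    ‖(fun i => (x i : UnitAddCircle))‖ ≤ intDist x := by
  refine le_ciInf fun p => (pi_norm_le_iff_of_nonneg (norm_nonneg _)).2 fun i => ?_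
  rw [UnitAddCircle.norm_eq]
  exact (round_le _ (p i)).trans (norm_le_pi_norm (x - fun i => (p i : ℝ)) i)

theorem norm_sub_round_le_norm_torus {k : ℕ} (x : Fin k → ℝ) :
    ‖x - (fun i => (round (x i) : ℝ))‖ ≤ ‖(fun i => (x i : UnitAddCircle))‖ := by
  refine (pi_norm_le_iff_of_nonneg (norm_nonneg _)).2 fun i => ?_
  refine le_trans (le_of_eq ?_) (norm_le_pi_norm (fun i => (x i : UnitAddCircle)) i)
  rw [UnitAddCircle.norm_eq, Real.norm_eq_abs, Pi.sub_apply]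

theorem intDist_eq_norm_torus {k : ℕ} (x : Fin k → ℝ) :
    intDist x = ‖(fun i => (x i : UnitAddCircle))‖ :=
  le_antisymm ((intDist_le_norm_sub x _).trans (norm_sub_round_le_norm_torus x))
    (norm_torus_le_intDist x)

theorem exists_norm_sub_eq_intDist {k : ℕ} (x : Fin k → ℝ) :
    ∃ p : Fin k → ℤ, ‖x - (fun i => (p i : ℝ))‖ = intDist x :=
  ⟨fun i => round (x i), le_antisymm
    ((norm_sub_round_le_norm_torus x).trans (norm_torus_le_intDist x)) (intDist_le_norm_sub x _)⟩

theorem ae_torus_mk {m : ℕ} {P : (Fin m → UnitAddCircle) → Prop} (h : ∀ᵐ b, P b) :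
    ∀ᵐ v : Fin m → ℝ, v ∈ Set.univ.pi (fun _ => Set.Ioo (0 : ℝ) 1) →
      P fun i => (v i : UnitAddCircle) := by
  have hmp := measurePreserving_pi (fun _ : Fin m => (volume : Measure ℝ).restrict (Set.Ioc 0 (0 + 1)))
    (fun _ : Fin m => (volume : Measure UnitAddCircle))
    fun _ => UnitAddCircle.measurePreserving_mk 0
  rw [← Measure.restrict_pi_pi] at hmp
  have h' := ae_imp_of_ae_restrict (hmp.quasiMeasurePreserving.ae h)
  filter_upwards [h'] with v hv hvO
  refine hv fun i hi => ?_
  have := hvO i hi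
  exact ⟨this.1, by rw [zero_add]; exact this.2.le⟩

/-- The inhomogeneous orbit `q ↦ A q mod ℤ^m` as a homomorphism. -/
noncomputable def torusHom {m n : ℕ} (A : Matrix (Fin m) (Fin n) ℝ) :
    (Fin n → ℤ) →+ (Fin m → UnitAddCircle) where
  toFun q i := (A.mulVec (fun j => (q j : ℝ)) i : UnitAddCircle)
  map_zero' := by
    ext i
    have : (fun j => (((0 : Fin n → ℤ) j : ℤ) : ℝ)) = 0 := by ext; simp
    rw [this, Matrix.mulVec_zero]
    rfl
  map_add' p q := by
    ext i
    have : (fun j => ((p + q) j : ℝ)) = (fun j => (p j : ℝ)) + fun j => (q j : ℝ) := by ext; simp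
    rw [this, Matrix.mulVec_add]
    rfl

theorem intDist_mulVec_sub {m n : ℕ} (A : Matrix (Fin m) (Fin n) ℝ) (q : Fin n → ℤ)
    (b : Fin m → ℝ) : intDist (A.mulVec (fun j => (q j : ℝ)) - b) =
      dist (torusHom A q) fun i => (b i : UnitAddCircle) := by
  rw [intDist_eq_norm_torus, dist_eq_norm]
  rfl

theorem intDist_mulVec {m n : ℕ} (A : Matrix (Fin m) (Fin n) ℝ) (q : Fin n → ℤ) :
    intDist (A.mulVec (fun j => (q j : ℝ))) = ‖torusHom A q‖ :=
  intDist_eq_norm_torus _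

theorem ae_infinite_intDist_lt {m n : ℕ} (hm : 0 < m) (hn : 0 < n)
    (A : Matrix (Fin m) (Fin n) ℝ) {ε : ℝ} (hε : 0 < ε) {ℓ : ℕ → ℕ}
    (hℓ : StrictMono ℓ) (hret : ∀ i, InReturnSeq m n A ε (ℓ i))
    {φ : ℝ → ℝ} (hφ : ∀ r, 0 < r → 0 < φ r) (hφa : ∀ r t, 0 < r → r ≤ t → φ t ≤ φ r)
    (hdiv : ¬ Summable fun i => (2 : ℝ) ^ (ℓ i * n) * φ (2 ^ ℓ i) ^ m) :
    ∀ᵐ b : Fin m → ℝ, b ∈ Set.univ.pi (fun _ => Set.Ioo (0 : ℝ) 1) →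
      {q : Fin n → ℤ | intDist (A.mulVec (fun j => (q j : ℝ)) - b) <
        φ ‖(fun j => (q j : ℝ))‖}.Infinite := by
  simp_rw [intDist_mulVec_sub]
  refine ae_torus_mk (P := fun b => {q : Fin n → ℤ | dist (torusHom A q) b <
    φ ‖(fun j => (q j : ℝ))‖}.Infinite) (ae_infinite_dist_lt hm hn (torusHom A) hε hℓ
    (fun i => (hret i).1) (fun i q hq hqℓ => ?_) hφ hφa hdiv)
  rw [← intDist_mulVec]
  by_contra! h
  refine (hret i).2 ⟨q, h, norm_pos_iff.2 fun h0 => hq ?_, hqℓ⟩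
  exact funext fun j => Int.cast_eq_zero.1 (congrFun h0 j)

theorem finite_norm_intCast_lt {n : ℕ} (R : ℝ) :
    {q : Fin n → ℤ | ‖(fun j => (q j : ℝ))‖ < R}.Finite := by
  refine (Set.finite_Icc (fun _ => -⌈R⌉ : Fin n → ℤ) (fun _ => ⌈R⌉)).subset fun q hq => ?_
  have h : ∀ j, |q j| ≤ ⌈R⌉ := fun j => by
    have h1 := (norm_le_pi_norm (fun j => (q j : ℝ)) j).trans (le_of_lt hq)
    rw [Real.norm_eq_abs] at h1
    exact_mod_cast h1.trans (Int.le_ceil R)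
  exact ⟨fun j => (abs_le.1 (h j)).1, fun j => (abs_le.1 (h j)).2⟩

theorem volume_pi_Ioo_zero_one (m : ℕ) :
    volume (Set.univ.pi fun _ : Fin m => Set.Ioo (0 : ℝ) 1) = 1 := by
  simp [volume_pi_pi]

theorem pi_Ioo_subset_Icc (m : ℕ) :
    (Set.univ.pi fun _ : Fin m => Set.Ioo (0 : ℝ) 1) ⊆ Set.Icc 0 1 :=
  fun _ h => ⟨fun i => (h i trivial).1.le, fun i => (h i trivial).2.le⟩

theorem hausdorffMeasure_WA_eq_top {m n : ℕ} (hm : 0 < m) (hn : 0 < n)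
    (A : Matrix (Fin m) (Fin n) ℝ) {ε : ℝ} (hε : 0 < ε)
    {ℓ : ℕ → ℕ} (hℓ : StrictMono ℓ) (hret : ∀ i, InReturnSeq m n A ε (ℓ i))
    {ψ : ℝ → ℝ} (hψ : ∀ r : ℝ, 0 < r → 0 < ψ r) (hψa : ∀ x y : ℝ, 0 < x → x ≤ y → ψ y ≤ ψ x)
    {s : ℝ} (hs0 : 0 ≤ s) (hsm : s < m)
    (hdiv : ¬ Summable fun i : ℕ => (2 : ℝ) ^ (ℓ i * n) * ψ ((2 : ℝ) ^ (ℓ i)) ^ s) :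
    Measure.hausdorffMeasure s (WA m n A ψ) = ∞ := by
  have hmR : (0 : ℝ) < m := by exact_mod_cast hm
  set U : ℕ → Set (Fin m → ℝ) := fun k => {b | ∃ q : Fin n → ℤ, (k : ℝ) ≤ ‖(fun j => (q j : ℝ))‖ ∧
    intDist (A.mulVec (fun j => (q j : ℝ)) - b) < ψ ‖(fun j => (q j : ℝ))‖} with hU
  have hsub : (Set.univ.pi fun _ : Fin m => Set.Ioo (0 : ℝ) 1) ∩ ⋂ k, U k ⊆ WA m n A ψ := by
    rintro b ⟨hbO, hbU⟩
    refine ⟨pi_Ioo_subset_Icc m hbO, fun hfin => ?_⟩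
    obtain ⟨M, hM⟩ := (hfin.image fun q : Fin n → ℤ => ‖(fun j => (q j : ℝ))‖).bddAbove
    obtain ⟨k, hk⟩ := exists_nat_gt M
    obtain ⟨q, hq1, hq2⟩ := Set.mem_iInter.1 hbU k
    exact absurd (hM (Set.mem_image_of_mem _ hq2)) (not_le.2 (hk.trans_le hq1))
  refine measure_mono_top hsub (hausdorffMeasure_inter_iInter_eq_top hs0 hsm
    (isOpen_set_pi Set.finite_univ fun _ _ => isOpen_Ioo) (volume_pi_Ioo_zero_one m) ?_)
  intro k η hη
  set c : ℝ := (η / 2 ^ s) ^ (1 / m : ℝ) with hc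
  have hc0 : 0 < c := by positivity
  have hcm : c ^ m * 2 ^ s = η := by
    rw [hc, ← Real.rpow_natCast, ← Real.rpow_mul (by positivity), one_div_mul_cancel hmR.ne',
      Real.rpow_one, div_mul_cancel₀ _ (by positivity)]
  set φ : ℝ → ℝ := fun r => min (c * ψ r ^ (s / m)) (r ^ (-(n : ℝ) / m)) with hφ
  have hexp : -(n : ℝ) / m < 0 := by
    rw [neg_div]
    exact neg_neg_of_pos (by positivity)
  have hφ0 : ∀ r, 0 < r → 0 < φ r := fun r hr =>
    lt_min (mul_pos hc0 (Real.rpow_pos_of_pos (hψ r hr) _)) (Real.rpow_pos_of_pos hr _)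
  have hφa : ∀ r t, 0 < r → r ≤ t → φ t ≤ φ r := fun r t hr hrt => by
    refine min_le_min (mul_le_mul_of_nonneg_left ?_ hc0.le) ?_
    · exact Real.rpow_le_rpow (hψ t (hr.trans_le hrt)).le (hψa r t hr hrt) (by positivity)
    · exact Real.rpow_le_rpow_of_nonpos hr hrt hexp.le
  have hψm : ∀ r, 0 < r → (c * ψ r ^ (s / m)) ^ m = c ^ m * ψ r ^ s := fun r hr => by
    rw [mul_pow, ← Real.rpow_natCast (ψ r ^ (s / m)), ← Real.rpow_mul (hψ r hr).le,
      div_mul_cancel₀ _ hmR.ne']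
  have hdivφ : ¬ Summable fun i => (2 : ℝ) ^ (ℓ i * n) * φ (2 ^ ℓ i) ^ m := by
    refine (summable_congr fun i => ?_).not.2 (not_summable_min hdiv (pow_pos hc0 m) one_pos)
    have hr : (0 : ℝ) < 2 ^ ℓ i := by positivity
    have h2 : (((2 : ℝ) ^ ℓ i) ^ (-(n : ℝ) / m)) ^ m = ((2 : ℝ) ^ (ℓ i * n))⁻¹ := by
      rw [← Real.rpow_natCast _ m, ← Real.rpow_mul hr.le, div_mul_cancel₀ _ hmR.ne',
        Real.rpow_neg hr.le, Real.rpow_natCast, pow_mul]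
    have h1 : φ (2 ^ ℓ i) ^ m = min (c ^ m * ψ (2 ^ ℓ i) ^ s) ((2 : ℝ) ^ (ℓ i * n))⁻¹ := by
      rw [← hψm _ hr, ← h2]
      have p1 : 0 ≤ c * ψ (2 ^ ℓ i) ^ (s / m) :=
        (mul_pos hc0 (Real.rpow_pos_of_pos (hψ _ hr) _)).le
      have p2 : 0 ≤ ((2 : ℝ) ^ ℓ i) ^ (-(n : ℝ) / m) := (Real.rpow_pos_of_pos hr _).le
      rcases le_total (c * ψ (2 ^ ℓ i) ^ (s / m)) (((2 : ℝ) ^ ℓ i) ^ (-(n : ℝ) / m)) with h | h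
      · simp only [hφ]
        rw [min_eq_left h, min_eq_left (pow_le_pow_left₀ p1 h m)]
      · simp only [hφ]
        rw [min_eq_right h, min_eq_right (pow_le_pow_left₀ p2 h m)]
    rw [h1, mul_min_of_nonneg _ _ (by positivity), mul_inv_cancel₀ (by positivity), mul_left_comm]
  have hφt : Tendsto φ atTop (𝓝 0) := by
    have h1 : Tendsto (fun r : ℝ => r ^ (-(n : ℝ) / m)) atTop (𝓝 0) := by
      rw [neg_div]
      exact tendsto_rpow_neg_atTop (by positivity)
    refine squeeze_zero' ?_ ?_ h1
    · filter_upwards [eventually_gt_atTop 0] with r hr using (hφ0 r hr).le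
    · exact Eventually.of_forall fun r => min_le_right _ _
  have hφp : Tendsto (fun r => φ r ^ ((m : ℝ) - s) * 2 ^ s) atTop (𝓝 0) := by
    have h1 := hφt.rpow_const (p := (m : ℝ) - s) (Or.inr (by linarith))
    rw [Real.zero_rpow (by linarith)] at h1
    simpa using h1.mul_const ((2 : ℝ) ^ s)
  filter_upwards [ae_infinite_intDist_lt hm hn A hε hℓ hret hφ0 hφa hdivφ] with b hb hbO τ hτ
  obtain ⟨R, hR⟩ := ((hφt.eventually_lt_const hτ).and ((hφp.eventually_lt_const hη).and
    ((eventually_gt_atTop 0).and (eventually_ge_atTop (k : ℝ))))).exists_forall_of_atTop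
  obtain ⟨q, hq, hqR⟩ := ((hb hbO).sdiff (finite_norm_intCast_lt R)).nonempty
  obtain ⟨hr1, hr2, hr0, hrk⟩ := hR _ (not_lt.1 hqR)
  set r := ‖(fun j => (q j : ℝ))‖ with hr
  obtain ⟨p, hp⟩ := exists_norm_sub_eq_intDist (A.mulVec (fun j => (q j : ℝ)) - b)
  have hρ := hφ0 r hr0
  have hψr := hψ r hr0
  refine ⟨A.mulVec (fun j => (q j : ℝ)) - fun i => (p i : ℝ), φ r, min (ψ r) (φ r) / 2, hρ, hr1.le,
    ?_, half_pos (lt_min hψr hρ), ?_, ?_, ?_⟩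
  · rw [dist_comm, dist_eq_norm, sub_right_comm, hp]
    exact le_of_lt hq
  · rw [mul_div_cancel₀ _ two_ne_zero]
    exact min_le_right _ _
  · rcases le_total (ψ r) (φ r) with h | h
    · rw [min_eq_left h, Real.div_rpow hψr.le zero_le_two, ← hcm, mul_assoc,
        mul_div_cancel₀ _ (by positivity), ← hψm r hr0]
      exact pow_le_pow_left₀ hρ.le (min_le_left _ _) m
    · rw [min_eq_right h, Real.div_rpow hρ.le zero_le_two]
      calc φ r ^ m = φ r ^ ((m : ℝ) - s) * 2 ^ s * (φ r ^ s / 2 ^ s) := by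
            rw [mul_assoc, mul_div_cancel₀ _ (by positivity), ← Real.rpow_add hρ, sub_add_cancel,
              Real.rpow_natCast]
        _ ≤ η * (φ r ^ s / 2 ^ s) := mul_le_mul_of_nonneg_right hr2.le (by positivity)
  · intro b' hb'
    refine ⟨q, hrk, (intDist_le_norm_sub _ p).trans_lt ?_⟩
    rw [Metric.mem_closedBall, dist_comm, dist_eq_norm, sub_right_comm] at hb'
    refine hb'.trans_lt ?_
    have := min_le_left (ψ r) (φ r)
    linarith

/-- Main theorem: if `A` is non-singular with infinite `ε`-return sequence
`ℓ_1 < ℓ_2 < ⋯`, then for any decreasing `ψ` and `0 ≤ s ≤ m`, divergence of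
`∑ 2^{ℓ_i n} ψ(2^{ℓ_i})^s` implies `ℋ^s(W_A(ψ)) = ℋ^s([0,1]^m)`. -/
theorem main_theorem (m n : ℕ) (hm : 0 < m) (hn : 0 < n)
    (A : Matrix (Fin m) (Fin n) ℝ) (ε : ℝ) (hε : 0 < ε)
    (ℓ : ℕ → ℕ) (hmono : StrictMono ℓ) (hret : ∀ i, InReturnSeq m n A ε (ℓ i))
    (ψ : ℝ → ℝ) (hψpos : ∀ r : ℝ, 0 < r → 0 < ψ r)
    (hψdec : ∀ x y : ℝ, 0 < x → x ≤ y → ψ y ≤ ψ x)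
    (s : ℝ) (hs0 : 0 ≤ s) (hsm : s ≤ m)
    (hdiv : ¬ Summable (fun i : ℕ => (2 : ℝ) ^ (ℓ i * n) * ψ ((2 : ℝ) ^ (ℓ i)) ^ s)) :
    μH[s] (WA m n A ψ) = μH[s] (Set.Icc (0 : Fin m → ℝ) 1) := by
  rcases hsm.lt_or_eq with hsm | rfl
  · have h := hausdorffMeasure_WA_eq_top hm hn A hε hmono hret hψpos hψdec hs0 hsm hdiv
    rw [h, measure_mono_top (fun b hb => hb.1) h]
  · have hdiv' : ¬ Summable fun i => (2 : ℝ) ^ (ℓ i * n) * ψ (2 ^ ℓ i) ^ m := by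
      simpa only [Real.rpow_natCast] using hdiv
    have hvol : (μH[(m : ℝ)] : Measure (Fin m → ℝ)) = volume := by
      simpa using hausdorffMeasure_pi_real (ι := Fin m)
    rw [hvol]
    refine le_antisymm (measure_mono fun b hb => hb.1) ?_
    calc volume (Set.Icc (0 : Fin m → ℝ) 1)
        = volume (Set.univ.pi fun _ : Fin m => Set.Ioo (0 : ℝ) 1) := by
          rw [volume_pi_Ioo_zero_one, Real.volume_Icc_pi]
          simp
      _ ≤ volume (WA m n A ψ) := measure_mono_ae <| by
          filter_upwards [ae_infinite_intDist_lt hm hn A hε hmono hret hψpos hψdec hdiv'] with b hb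
            hbO
          exact ⟨pi_Ioo_subset_Icc m hbO, hb hbO⟩
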